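/- arXiv:2601.09339 — 7 statements merged into one kernel-verified Lean document; each statement's English description precedes it below -/
import Mathlib

section
/- There exists a strategy q : Ω* → P(Ω) for Skeptic such that for every infinite sequence ω : ℕ≥1 → Ω of Reality's moves, defining Skeptic's capital by K_0 = 1 and K_n = K_{n-1} · q(ω_1⋯ω_{n-1})(ω_n) / p(ω_n), the following holds: either K_n → ∞ as n → ∞, or for every a ∈ Ω, (1/n) · #{1 ≤ i ≤ n : ω_i = a} → p(a) as n → ∞. -/
open Filter

/-- The capital, as a function of the history (latest move first), of the strategy that bets the
fixed fraction `ε` on the move `b` until its capital reaches `C`, and then stops betting. -/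
noncomputable def stoppedCapital {Ω : Type*} [DecidableEq Ω] (p : Ω → ℝ) (b : Ω) (ε C : ℝ) :
    List Ω → ℝ
  | [] => 1
  | a :: h =>
    if C ≤ stoppedCapital p b ε C h then stoppedCapital p b ε C h
    else stoppedCapital p b ε C h * (1 + ε * ((if a = b then 1 else 0) - p b))

/-- The first `n` terms of the sequence `ω 1, ω 2, …`, latest first. -/
def reverseHistory {Ω : Type*} (ω : ℕ → Ω) : ℕ → List Ω
  | 0 => []
  | n + 1 => ω (n + 1) :: reverseHistory ω n

lemma reverse_map_range_eq_reverseHistory {Ω : Type*} (ω : ℕ → Ω) (n : ℕ) :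
    ((List.range n).map fun i => ω (i + 1)).reverse = reverseHistory ω n := by
  induction n with
  | zero => rfl
  | succ n ih => simp [List.range_succ, reverseHistory, ← ih]

lemma exp_sub_two_mul_sq_le {y : ℝ} (hy : |y| ≤ 1 / 2) : Real.exp (y - 2 * y ^ 2) ≤ 1 + y := by
  obtain ⟨h1, h2⟩ := abs_le.mp hy
  have h3 : 1 - y + 2 * y ^ 2 ≤ Real.exp (-(y - 2 * y ^ 2)) := by
    have := Real.add_one_le_exp (-(y - 2 * y ^ 2))
    linarith
  have h4 : 1 ≤ (1 + y) * Real.exp (-(y - 2 * y ^ 2)) := by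
    calc (1 : ℝ) ≤ (1 + y) * (1 - y + 2 * y ^ 2) := by
          nlinarith [mul_nonneg (sq_nonneg y) (by linarith : 0 ≤ 1 + 2 * y)]
      _ ≤ _ := by gcongr; linarith
  rw [Real.exp_neg, ← div_eq_mul_inv, le_div_iff₀ (Real.exp_pos _)] at h4
  linarith

section StoppedCapital

variable {Ω : Type*} [DecidableEq Ω] {p : Ω → ℝ} {b : Ω} {ε C : ℝ}

lemma abs_indicator_sub_le_one (hb : p b ∈ Set.Ioo (0 : ℝ) 1) (a : Ω) :
    |(if a = b then (1 : ℝ) else 0) - p b| ≤ 1 := by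
  obtain ⟨h0, h1⟩ := hb
  split_ifs <;> rw [abs_le] <;> constructor <;> linarith

lemma abs_bet_le_half (hb : p b ∈ Set.Ioo (0 : ℝ) 1) (hε : |ε| ≤ 1 / 2) (a : Ω) :
    |ε * ((if a = b then (1 : ℝ) else 0) - p b)| ≤ 1 / 2 := by
  rw [abs_mul]
  nlinarith [abs_indicator_sub_le_one hb a, abs_nonneg ε,
    abs_nonneg ((if a = b then (1 : ℝ) else 0) - p b)]

lemma stoppedCapital_pos (hb : p b ∈ Set.Ioo (0 : ℝ) 1) (hε : |ε| ≤ 1 / 2) (h : List Ω) :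
    0 < stoppedCapital p b ε C h := by
  induction h with
  | nil => simp [stoppedCapital]
  | cons a h ih =>
    rw [stoppedCapital]
    by_cases hC : C ≤ stoppedCapital p b ε C h
    · rwa [if_pos hC]
    · rw [if_neg hC]
      exact mul_pos ih (by linarith [(abs_le.mp (abs_bet_le_half hb hε a)).1])

lemma stoppedCapital_le_two_pow (hb : p b ∈ Set.Ioo (0 : ℝ) 1) (hε : |ε| ≤ 1 / 2) (h : List Ω) :
    stoppedCapital p b ε C h ≤ 2 ^ h.length := by
  induction h with
  | nil => simp [stoppedCapital]
  | cons a h ih =>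
    have hpos := stoppedCapital_pos (C := C) hb hε h
    rw [stoppedCapital, List.length_cons, pow_succ]
    by_cases hC : C ≤ stoppedCapital p b ε C h
    · rw [if_pos hC]
      linarith
    · rw [if_neg hC]
      have := (abs_le.mp (abs_bet_le_half hb hε a)).2
      exact mul_le_mul ih (by linarith)
        (by linarith [(abs_le.mp (abs_bet_le_half hb hε a)).1]) (by positivity)

lemma sum_mul_stoppedCapital_cons [Fintype Ω] (hpsum : ∑ a, p a = 1) (h : List Ω) :
    ∑ a, p a * stoppedCapital p b ε C (a :: h) = stoppedCapital p b ε C h := by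
  simp only [stoppedCapital]
  split_ifs with hC
  · rw [← Finset.sum_mul, hpsum, one_mul]
  · have key : ∀ a, p a * (stoppedCapital p b ε C h * (1 + ε * ((if a = b then 1 else 0) - p b)))
        = p a * (stoppedCapital p b ε C h * (1 - ε * p b))
          + (if a = b then p a * (stoppedCapital p b ε C h * ε) else 0) := by
      intro a
      split_ifs <;> ring
    simp only [key, Finset.sum_add_distrib, ← Finset.sum_mul, hpsum, Finset.sum_ite_eq',
      Finset.mem_univ, if_true]
    ring

lemma le_stoppedCapital_of_le {ω : ℕ → Ω} {m n : ℕ} (hmn : m ≤ n)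
    (hm : C ≤ stoppedCapital p b ε C (reverseHistory ω m)) :
    C ≤ stoppedCapital p b ε C (reverseHistory ω n) := by
  induction n, hmn using Nat.le_induction with
  | base => exact hm
  | succ n _ ih => rwa [reverseHistory, stoppedCapital, if_pos ih]

lemma exp_le_stoppedCapital (hb : p b ∈ Set.Ioo (0 : ℝ) 1) (hε : |ε| ≤ 1 / 2) {ω : ℕ → Ω}
    (hC : ∀ n, stoppedCapital p b ε C (reverseHistory ω n) < C) (n : ℕ) :
    Real.exp (ε * ((((Finset.Icc 1 n).filter fun i => ω i = b).card : ℝ) - n * p b)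
      - 2 * ε ^ 2 * n) ≤ stoppedCapital p b ε C (reverseHistory ω n) := by
  induction n with
  | zero => simp [reverseHistory, stoppedCapital]
  | succ n ih =>
    rw [reverseHistory, stoppedCapital, if_neg (not_le.mpr (hC n))]
    set x : ℝ := (if ω (n + 1) = b then 1 else 0) - p b with hx
    have hcard : (((Finset.Icc 1 (n + 1)).filter fun i => ω i = b).card : ℝ)
        = ((Finset.Icc 1 n).filter fun i => ω i = b).card + (x + p b) := by
      rw [← Finset.insert_Icc_right_eq_Icc_add_one (by omega), Finset.filter_insert, hx]
      split_ifs
      · rw [Finset.card_insert_of_notMem (by simp)]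
        push_cast
        ring
      · simp
    have hx1 : x ^ 2 ≤ 1 := (sq_le_one_iff_abs_le_one x).mpr (abs_indicator_sub_le_one hb _)
    calc _ ≤ Real.exp ((ε * ((((Finset.Icc 1 n).filter fun i => ω i = b).card : ℝ) - n * p b)
              - 2 * ε ^ 2 * n) + (ε * x - 2 * (ε * x) ^ 2)) := by
          rw [hcard]
          apply Real.exp_le_exp.mpr
          push_cast
          nlinarith [mul_le_mul_of_nonneg_left hx1 (sq_nonneg ε)]
      _ ≤ _ := by
          rw [Real.exp_add]
          exact mul_le_mul ih (exp_sub_two_mul_sq_le (abs_bet_le_half hb hε _))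
            (Real.exp_pos _).le (stoppedCapital_pos hb hε _).le

lemma eventually_le_stoppedCapital (hb : p b ∈ Set.Ioo (0 : ℝ) 1) (hε : |ε| ≤ 1 / 2) {ω : ℕ → Ω}
    {δ : ℝ} (hεδ : 2 * ε ^ 2 < δ)
    (hfreq : ∃ᶠ n : ℕ in atTop,
      δ * n ≤ ε * ((((Finset.Icc 1 n).filter fun i => ω i = b).card : ℝ) - n * p b)) :
    ∀ᶠ n in atTop, C ≤ stoppedCapital p b ε C (reverseHistory ω n) := by
  suffices ∃ m, C ≤ stoppedCapital p b ε C (reverseHistory ω m) by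
    obtain ⟨m, hm⟩ := this
    filter_upwards [eventually_ge_atTop m] with n hn using le_stoppedCapital_of_le hn hm
  by_contra! hC
  have hlim : Tendsto (fun n : ℕ => (δ - 2 * ε ^ 2) * (n : ℝ)) atTop atTop :=
    tendsto_natCast_atTop_atTop.const_mul_atTop (by linarith)
  obtain ⟨n, hn, hCn⟩ := (hfreq.and_eventually (hlim.eventually_ge_atTop C)).exists
  have h1 := exp_le_stoppedCapital hb hε hC n
  have h2 := Real.add_one_le_exp
    (ε * ((((Finset.Icc 1 n).filter fun i => ω i = b).card : ℝ) - n * p b) - 2 * ε ^ 2 * n)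
  linarith [hC n]

end StoppedCapital

/-- If the empirical frequency of `b` does not converge to `p b`, then betting a suitable fixed
fraction on or against `b` makes arbitrarily much money. -/
lemma exists_bet_of_not_tendsto {Ω : Type*} [DecidableEq Ω] {p : Ω → ℝ} {b : Ω}
    (hb : p b ∈ Set.Ioo (0 : ℝ) 1) {ω : ℕ → Ω}
    (hω : ¬ Tendsto (fun n => (((Finset.Icc 1 n).filter fun i => ω i = b).card : ℝ) / n)
      atTop (nhds (p b))) :
    ∃ z : ℤ, ∀ C, ∀ᶠ n in atTop,
      C ≤ stoppedCapital p b ((z : ℝ)⁻¹ / 2) C (reverseHistory ω n) := by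
  rw [Metric.tendsto_nhds] at hω
  push Not at hω
  obtain ⟨δ, hδ, hω⟩ := hω
  obtain ⟨m, hm⟩ := exists_nat_gt (1 / δ)
  have hm0 : (0 : ℝ) < m := (by positivity : 0 < 1 / δ).trans hm
  have hm1 : (1 : ℝ) ≤ m := by exact_mod_cast hm0
  have hmδ : (m : ℝ)⁻¹ < δ := by
    rw [inv_lt_comm₀ hm0 hδ]
    simpa using hm
  have hinv1 : (m : ℝ)⁻¹ ≤ 1 := inv_le_one_of_one_le₀ hm1
  have hinv0 : (0 : ℝ) < (m : ℝ)⁻¹ := inv_pos.mpr hm0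
  have hdev : ∃ᶠ n : ℕ in atTop,
      δ * n ≤ (((Finset.Icc 1 n).filter fun i => ω i = b).card : ℝ) - n * p b ∨
      δ * n ≤ -((((Finset.Icc 1 n).filter fun i => ω i = b).card : ℝ) - n * p b) := by
    refine (hω.and_eventually (eventually_gt_atTop 0)).mono ?_
    rintro n ⟨hn, hn0⟩
    have hn0' : (0 : ℝ) < n := by exact_mod_cast hn0
    rw [← le_abs]
    rw [Real.dist_eq] at hn
    calc δ * n ≤ |(((Finset.Icc 1 n).filter fun i => ω i = b).card : ℝ) / n - p b| * n := by
          gcongr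
      _ = |((((Finset.Icc 1 n).filter fun i => ω i = b).card : ℝ) / n - p b) * n| := by
          rw [abs_mul, abs_of_pos hn0']
      _ = _ := by
          congr 1
          field_simp
  have hbound : 2 * ((m : ℝ)⁻¹ / 2) ^ 2 < (m : ℝ)⁻¹ / 2 * δ := by nlinarith
  rcases frequently_or_distrib.mp hdev with h | h
  · refine ⟨m, fun C => eventually_le_stoppedCapital (δ := (m : ℝ)⁻¹ / 2 * δ) hb ?_ ?_ ?_⟩
    · rw [Int.cast_natCast, abs_of_pos (by positivity)]
      linarith
    · simpa using hbound
    · refine h.mono fun n hn => ?_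
      rw [Int.cast_natCast, mul_assoc]
      gcongr
  · refine ⟨-m, fun C => eventually_le_stoppedCapital (δ := (m : ℝ)⁻¹ / 2 * δ) hb ?_ ?_ ?_⟩
    · rw [Int.cast_neg, Int.cast_natCast, inv_neg, neg_div, abs_neg, abs_of_pos (by positivity)]
      linarith
    · rw [Int.cast_neg, Int.cast_natCast, inv_neg, neg_div, neg_sq]
      exact hbound
    · refine h.mono fun n hn => ?_
      rw [Int.cast_neg, Int.cast_natCast, inv_neg, neg_div, neg_mul, ← mul_neg, mul_assoc]
      gcongr

/-- There is a positive martingale that tends to infinity along every sequence of moves violating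
the law of large numbers. -/
lemma exists_martingale_tendsto_atTop {Ω : Type*} [Fintype Ω] [Nonempty Ω] [DecidableEq Ω]
    (p : Ω → ℝ) (hp : ∀ a, p a ∈ Set.Ioo (0 : ℝ) 1) (hpsum : ∑ a, p a = 1) :
    ∃ M : List Ω → ℝ, (∀ h, 0 < M h) ∧ (∀ h, ∑ a, p a * M (a :: h) = M h) ∧
      ∀ (ω : ℕ → Ω) (b : Ω),
        ¬ Tendsto (fun n => (((Finset.Icc 1 n).filter fun i => ω i = b).card : ℝ) / n)
          atTop (nhds (p b)) →
        Tendsto (fun n => M (reverseHistory ω n)) atTop atTop := by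
  obtain ⟨f, hf⟩ := exists_surjective_nat (Ω × ℤ)
  let N : ℕ → List Ω → ℝ := fun k => stoppedCapital p (f k.unpair.1).1
    (((f k.unpair.1).2 : ℝ)⁻¹ / 2) (2 ^ k)
  have hε : ∀ z : ℤ, |(z : ℝ)⁻¹ / 2| ≤ 1 / 2 := by
    intro z
    rw [abs_div, abs_inv, abs_two]
    rcases eq_or_ne z 0 with rfl | hz
    · simp
    · have : (1 : ℝ) ≤ |(z : ℝ)| := by exact_mod_cast Int.one_le_abs hz
      gcongr
      exact inv_le_one_of_one_le₀ this
  have hNpos : ∀ k h, 0 < N k h := fun k h => stoppedCapital_pos (hp _) (hε _) h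
  have hterm : ∀ k h, 0 < (1 / 2 : ℝ) ^ k * N k h := fun k h => mul_pos (by positivity) (hNpos k h)
  have hsum : ∀ h, Summable fun k => (1 / 2 : ℝ) ^ k * N k h := fun h =>
    (summable_geometric_two.mul_right (2 ^ h.length)).of_nonneg_of_le (fun k => (hterm k h).le)
      fun k => mul_le_mul_of_nonneg_left (stoppedCapital_le_two_pow (hp _) (hε _) h)
        (by positivity)
  refine ⟨fun h => ∑' k, (1 / 2 : ℝ) ^ k * N k h, fun h => ?_, fun h => ?_, fun ω b hω => ?_⟩
  · exact (hsum h).tsum_pos (fun k => (hterm k h).le) 0 (hterm 0 h)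
  · refine HasSum.unique (hasSum_sum fun a _ => ((hsum (a :: h)).hasSum.mul_left (p a))) ?_
    convert (hsum h).hasSum using 2 with k
    simp only [N]
    rw [← sum_mul_stoppedCapital_cons hpsum h, Finset.mul_sum]
    exact Finset.sum_congr rfl fun a _ => by ring
  · obtain ⟨z, hz⟩ := exists_bet_of_not_tendsto (hp b) hω
    obtain ⟨i, hi⟩ := hf (b, z)
    let k : ℕ → ℕ := fun j => Nat.pair i j
    have hk : Function.Injective k := fun j₁ j₂ h => (Nat.pair_eq_pair.mp h).2
    refine tendsto_atTop.mpr fun R => ?_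
    obtain ⟨r, hr⟩ := exists_nat_ge R
    have hev : ∀ᶠ n in atTop, ∀ j ∈ Finset.range r,
        (2 : ℝ) ^ k j ≤ N (k j) (reverseHistory ω n) := by
      refine (Finset.eventually_all _).mpr fun j _ => ?_
      simpa [N, k, hi] using hz (2 ^ k j)
    filter_upwards [hev] with n hn
    calc R ≤ r := hr
      _ = ∑ j ∈ Finset.range r, (1 : ℝ) := by simp
      _ ≤ ∑ j ∈ Finset.range r, (1 / 2 : ℝ) ^ k j * N (k j) (reverseHistory ω n) := by
          refine Finset.sum_le_sum fun j hj => ?_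
          calc (1 : ℝ) = (1 / 2) ^ k j * 2 ^ k j := by rw [← mul_pow]; norm_num
            _ ≤ _ := mul_le_mul_of_nonneg_left (hn j hj) (by positivity)
      _ = ∑ l ∈ (Finset.range r).map ⟨k, hk⟩, (1 / 2 : ℝ) ^ l * N l (reverseHistory ω n) := by
          rw [Finset.sum_map]
          rfl
      _ ≤ _ := (hsum _).sum_le_tsum _ fun l _ => (hterm l _).le

/-- **Game-theoretic law of large numbers for the simple predictive game.**
There exists a strategy `q : Ω* → P(Ω)` for Skeptic such that for every infinite
sequence `ω` of Reality's moves, with capital `K₀ = 1`,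
`Kₙ = Kₙ₋₁ · q(ω₁⋯ωₙ₋₁)(ωₙ) / p(ωₙ)`, either `Kₙ → ∞` or the empirical frequency
of every `a ∈ Ω` converges to `p a`. -/
theorem simple_predictive_game_LLN
    {Ω : Type*} [Fintype Ω] [Nonempty Ω] [DecidableEq Ω]
    (p : Ω → ℝ) (hp : ∀ a, p a ∈ Set.Ioo (0 : ℝ) 1) (hpsum : ∑ a, p a = 1) :
    ∃ q : List Ω → Ω → ℝ,
      (∀ h, (∀ a, q h a ∈ Set.Ioo (0 : ℝ) 1) ∧ ∑ a, q h a = 1) ∧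
      ∀ ω : ℕ → Ω, ∀ K : ℕ → ℝ, K 0 = 1 →
        (∀ n, 1 ≤ n →
          K n = K (n - 1) * q ((List.range (n - 1)).map fun i => ω (i + 1)) (ω n) / p (ω n)) →
        (Tendsto K atTop atTop ∨
          ∀ a, Tendsto
            (fun n => (((Finset.Icc 1 n).filter fun i => ω i = a).card : ℝ) / n)
            atTop (nhds (p a))) := by
  obtain ⟨M, hMpos, hM, hMtop⟩ := exists_martingale_tendsto_atTop p hp hpsum
  refine ⟨fun h a => p a * M (a :: h.reverse) / M h.reverse, fun h => ?_, fun ω K hK0 hK => ?_⟩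
  · have hpos : ∀ a, 0 < p a * M (a :: h.reverse) / M h.reverse := fun a =>
      div_pos (mul_pos (hp a).1 (hMpos _)) (hMpos _)
    have hone : ∑ a, p a * M (a :: h.reverse) / M h.reverse = 1 := by
      rw [← Finset.sum_div, hM, div_self (hMpos _).ne']
    refine ⟨fun a => ⟨hpos a, ?_⟩, hone⟩
    obtain ⟨c, hc⟩ : ∃ c, c ≠ a := by
      by_contra! hall
      have : ∑ c, p c = p a := Fintype.sum_eq_single a fun c hc => absurd (hall c) hc
      linarith [(hp a).2]
    rw [← hone]
    exact Finset.single_lt_sum hc (Finset.mem_univ a) (Finset.mem_univ c) (hpos c)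
      fun d _ _ => (hpos d).le
  · have hKM : ∀ n, K n = M (reverseHistory ω n) / M [] := by
      intro n
      induction n with
      | zero => rw [hK0, reverseHistory, div_self (hMpos _).ne']
      | succ n ih =>
        have hp0 := (hp (ω (n + 1))).1.ne'
        have hM0 := (hMpos (reverseHistory ω n)).ne'
        have hM1 := (hMpos []).ne'
        rw [hK (n + 1) (by omega), Nat.add_sub_cancel, ih]
        beta_reduce
        rw [reverse_map_range_eq_reverseHistory, reverseHistory]
        field_simp
    by_cases hω : ∀ a, Tendsto
        (fun n => (((Finset.Icc 1 n).filter fun i => ω i = a).card : ℝ) / n) atTop (nhds (p a))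
    · exact Or.inr hω
    · obtain ⟨b, hb⟩ := not_forall.mp hω
      left
      rw [funext hKM]
      exact (hMtop ω b hb).atTop_div_const (hMpos [])
end

section
/- Let (τ_k)_{k≥1} be a sequence in Ω⁴ and (u_k)_{k≥1} a sequence in Θ, and define the capital process W_0 = 1, W_n = W_{n−1} · P̂_n(τ_n; u_n) / (Q̂_n(τ_n) · R̂_n(u_n)). If it is not the case that for every τ ∈ Ω⁴ and u ∈ Θ one has P̂_n(τ;u) − Q̂_n(τ)·R̂_n(u) → 0 as n → ∞, then limsup_{n→∞} W_n = ∞. -/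
open Filter

/-- The two-point set `{+1, -1}` of measurement outcomes. -/
abbrev Sign := ({1, -1} : Finset ℤ)

/-- The four preassigned outcomes: an element of `Ω⁴`. -/
abbrev O4 := Sign × Sign × Sign × Sign

/-- The set of joint measurement settings `Θ = {1,2} × {3,4}`. -/
def ThetaF : Finset (ℕ × ℕ) := ({1, 2} : Finset ℕ) ×ˢ ({3, 4} : Finset ℕ)

/-- Joint count `T_n(τ; u) = #{k ≤ n : τ_k = τ, u_k = u}`. -/
def Tj (τ : ℕ → O4) (u : ℕ → ℕ × ℕ) (n : ℕ) (a : O4) (v : ℕ × ℕ) : ℕ :=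
  ((Finset.Icc 1 n).filter fun k => τ k = a ∧ u k = v).card

/-- Marginal count `T_n(τ) = #{k ≤ n : τ_k = τ}`. -/
def Tt (τ : ℕ → O4) (n : ℕ) (a : O4) : ℕ :=
  ((Finset.Icc 1 n).filter fun k => τ k = a).card

/-- Marginal count `T_n(u) = #{k ≤ n : u_k = u}`. -/
def Tu (u : ℕ → ℕ × ℕ) (n : ℕ) (v : ℕ × ℕ) : ℕ :=
  ((Finset.Icc 1 n).filter fun k => u k = v).card

section Counting

variable {α : Type*} [DecidableEq α]

/-- The number of indices `1 ≤ k ≤ n` at which the sequence `x` takes the value `a`. -/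
def visitCount (x : ℕ → α) (n : ℕ) (a : α) : ℕ :=
  ((Finset.Icc 1 n).filter fun k => x k = a).card

lemma visitCount_succ (x : ℕ → α) (n : ℕ) (a : α) :
    visitCount x (n + 1) a = visitCount x n a + if x (n + 1) = a then 1 else 0 := by
  unfold visitCount
  rw [← Finset.insert_Icc_right_eq_Icc_add_one (by omega), Finset.filter_insert]
  split_ifs
  · rw [Finset.card_insert_of_notMem (by simp)]
  · simp

lemma visitCount_le (x : ℕ → α) (n : ℕ) (a : α) : visitCount x n a ≤ n :=
  (Finset.card_filter_le _ _).trans (by simp)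

lemma visitCount_self_pos (x : ℕ → α) (n : ℕ) : 0 < visitCount x (n + 1) (x (n + 1)) := by
  simp [visitCount_succ]

lemma sum_visitCount (x : ℕ → α) (s : Finset α) (hx : ∀ k, x k ∈ s) (n : ℕ) :
    ∑ a ∈ s, visitCount x n a = n := by
  have h := Finset.card_eq_sum_card_fiberwise (s := Finset.Icc 1 n) (t := s) (f := x)
    (fun k _ => hx k)
  simpa [visitCount] using h.symm

lemma prod_factorial_visitCount_succ (x : ℕ → α) (s : Finset α) (hx : ∀ k, x k ∈ s) (n : ℕ) :
    ∏ a ∈ s, (visitCount x (n + 1) a).factorial =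
      visitCount x (n + 1) (x (n + 1)) * ∏ a ∈ s, (visitCount x n a).factorial := by
  rw [← Finset.mul_prod_erase s _ (hx (n + 1)), ← Finset.mul_prod_erase s _ (hx (n + 1)),
    ← mul_assoc]
  congr 1
  · simp [visitCount_succ, Nat.factorial_succ]
  · refine Finset.prod_congr rfl fun a ha => ?_
    rw [visitCount_succ, if_neg (Finset.ne_of_mem_erase ha).symm, add_zero]

end Counting

section Entropy

lemma mul_log_sub_le_log_factorial (n : ℕ) :
    (n : ℝ) * Real.log n - n ≤ Real.log n.factorial := by
  rcases Nat.eq_zero_or_pos n with rfl | hn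
  · simp
  · have h := Stirling.le_log_factorial_stirling hn.ne'
    have h1 : 0 ≤ Real.log n := Real.log_natCast_nonneg n
    have h2 : 0 ≤ Real.log (2 * Real.pi) := Real.log_nonneg (by linarith [Real.pi_gt_three])
    linarith

lemma log_factorial_le (n : ℕ) :
    Real.log n.factorial ≤ (n : ℝ) * Real.log n - n + (Real.log (n + 1) + 1) := by
  suffices h : ∀ m : ℕ, Real.log (m + 1).factorial ≤
      ((m : ℝ) + 1) * Real.log (m + 1) - (m + 1) + (Real.log (m + 1) + 1) by
    cases n with
    | zero => simp
    | succ m =>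
      have h1 : Real.log ((m : ℝ) + 1) ≤ Real.log ((m : ℝ) + 1 + 1) :=
        Real.log_le_log (by positivity) (by linarith)
      push_cast
      linarith [h m]
  intro m
  induction m with
  | zero => simp
  | succ m ih =>
    have hx : (0 : ℝ) < m + 1 := by positivity
    have hy : (0 : ℝ) < m + 1 + 1 := by positivity
    have hlog := Real.log_le_sub_one_of_pos (div_pos hx hy)
    rw [Real.log_div hx.ne' hy.ne', div_sub_one hy.ne', le_div_iff₀ hy] at hlog
    rw [Nat.factorial_succ, Nat.cast_mul, Real.log_mul (by positivity) (by positivity)]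
    push_cast
    nlinarith

/-- A pointwise lower bound on the relative entropy by the squared Hellinger distance. -/
lemma sub_add_sq_sqrt_sub_le_mul_log {x y : ℝ} (hx : 0 < x) (hy : 0 < y) :
    x - y + (√x - √y) ^ 2 ≤ x * (Real.log x - Real.log y) := by
  have hsx := Real.sqrt_pos.2 hx
  have hsy := Real.sqrt_pos.2 hy
  have h := Real.log_le_sub_one_of_pos (div_pos hsy hsx)
  rw [Real.log_div hsy.ne' hsx.ne', Real.log_sqrt hy.le, Real.log_sqrt hx.le] at h
  have h1 : x * (√y / √x) = √x * √y := by
    field_simp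
    rw [Real.sq_sqrt hx.le]
  have h2 := mul_le_mul_of_nonneg_left h hx.le
  nlinarith [Real.sq_sqrt hx.le, Real.sq_sqrt hy.le]

/-- The unnormalized mutual information of a nonnegative table dominates the squared Hellinger
defect of independence at each single cell. -/
lemma sq_sqrt_sub_le_mutual_information {A B : Type*} (s : Finset A) (t : Finset B)
    (p : A → B → ℝ) (r : A → ℝ) (c : B → ℝ) (N : ℝ) (hN : 0 < N)
    (hp : ∀ a ∈ s, ∀ b ∈ t, 0 ≤ p a b)
    (hr : ∀ a ∈ s, ∑ b ∈ t, p a b = r a) (hc : ∀ b ∈ t, ∑ a ∈ s, p a b = c b)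
    (hrN : ∑ a ∈ s, r a = N) (hcN : ∑ b ∈ t, c b = N) {a₀ : A} {b₀ : B}
    (ha₀ : a₀ ∈ s) (hb₀ : b₀ ∈ t) :
    (√(p a₀ b₀) - √(r a₀ * c b₀ / N)) ^ 2 ≤
      N * Real.log N + ∑ a ∈ s, ∑ b ∈ t, p a b * Real.log (p a b)
        - ∑ a ∈ s, r a * Real.log (r a) - ∑ b ∈ t, c b * Real.log (c b) := by
  have hr0 : ∀ a ∈ s, 0 ≤ r a := fun a ha => hr a ha ▸ Finset.sum_nonneg (hp a ha)
  have hc0 : ∀ b ∈ t, 0 ≤ c b := fun b hb =>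
    hc b hb ▸ Finset.sum_nonneg fun a ha => hp a ha b hb
  have hcell : ∀ a ∈ s, ∀ b ∈ t,
      p a b - r a * c b / N + (√(p a b) - √(r a * c b / N)) ^ 2 ≤
        p a b * (Real.log N + Real.log (p a b) - Real.log (r a) - Real.log (c b)) := by
    intro a ha b hb
    rcases (hp a ha b hb).eq_or_lt with h0 | hpos
    · have hy : 0 ≤ r a * c b / N := div_nonneg (mul_nonneg (hr0 a ha) (hc0 b hb)) hN.le
      rw [← h0]
      simp [Real.sq_sqrt hy]
    · have hra : 0 < r a := hpos.trans_le
        (hr a ha ▸ Finset.single_le_sum (fun b hb => hp a ha b hb) hb)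
      have hcb : 0 < c b := hpos.trans_le
        (hc b hb ▸ Finset.single_le_sum (f := fun a => p a b) (fun a ha => hp a ha b hb) ha)
      have h := sub_add_sq_sqrt_sub_le_mul_log hpos (div_pos (mul_pos hra hcb) hN)
      rw [Real.log_div (by positivity) hN.ne', Real.log_mul hra.ne' hcb.ne'] at h
      refine h.trans_eq ?_
      ring
  have hsum := Finset.sum_le_sum fun a ha => Finset.sum_le_sum fun b hb => hcell a ha b hb
  have hpN : ∑ a ∈ s, ∑ b ∈ t, p a b = N := by rw [Finset.sum_congr rfl hr, hrN]
  have hqN : ∑ a ∈ s, ∑ b ∈ t, r a * c b / N = N := by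
    simp_rw [← Finset.sum_div, ← Finset.mul_sum, hcN, ← Finset.sum_mul, hrN]
    field_simp
  have hsq : (√(p a₀ b₀) - √(r a₀ * c b₀ / N)) ^ 2 ≤
      ∑ a ∈ s, ∑ b ∈ t, (√(p a b) - √(r a * c b / N)) ^ 2 :=
    (Finset.single_le_sum (f := fun b => (√(p a₀ b) - √(r a₀ * c b / N)) ^ 2)
      (fun b _ => sq_nonneg _) hb₀).trans
    (Finset.single_le_sum (f := fun a => ∑ b ∈ t, (√(p a b) - √(r a * c b / N)) ^ 2)
      (fun a _ => Finset.sum_nonneg fun b _ => sq_nonneg _) ha₀)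
  have hrlog : ∑ a ∈ s, ∑ b ∈ t, p a b * Real.log (r a) = ∑ a ∈ s, r a * Real.log (r a) :=
    Finset.sum_congr rfl fun a ha => by rw [← Finset.sum_mul, hr a ha]
  have hclog : ∑ a ∈ s, ∑ b ∈ t, p a b * Real.log (c b) = ∑ b ∈ t, c b * Real.log (c b) := by
    rw [Finset.sum_comm]
    exact Finset.sum_congr rfl fun b hb => by rw [← Finset.sum_mul, hc b hb]
  have hNlog : ∑ a ∈ s, ∑ b ∈ t, p a b * Real.log N = N * Real.log N := by
    simp_rw [← Finset.sum_mul, hpN]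
  simp only [mul_add, mul_sub, Finset.sum_add_distrib, Finset.sum_sub_distrib, hrlog, hclog,
    hNlog, hpN, hqN] at hsum
  linarith

/-- In a table with total mass `n`, an independence defect of at least `δ` in relative frequency
gives a squared Hellinger defect of at least `n δ² / 4`. -/
lemma mul_sq_div_four_le_sq_sqrt_sub {x r c n δ : ℝ} (hn : 0 < n) (hδ : 0 ≤ δ)
    (hx : 0 ≤ x) (hxn : x ≤ n) (hr : 0 ≤ r) (hrn : r ≤ n) (hc : 0 ≤ c) (hcn : c ≤ n)
    (h : δ ≤ |x / n - r / n * (c / n)|) :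
    n * (δ ^ 2 / 4) ≤ (√x - √(r * c / n)) ^ 2 := by
  set y := r * c / n with hy
  have hy0 : 0 ≤ y := by positivity
  have hyn : y ≤ n := by
    rw [hy, div_le_iff₀ hn]
    exact mul_le_mul hrn hcn hc hn.le
  have hd : n * δ ≤ |x - y| := by
    have : x / n - r / n * (c / n) = (x - y) / n := by rw [hy]; field_simp
    rw [this, abs_div, abs_of_pos hn, le_div_iff₀ hn] at h
    linarith
  have hsq : (n * δ) ^ 2 ≤ (x - y) ^ 2 := by
    rw [← sq_abs (x - y)]
    exact pow_le_pow_left₀ (by positivity) hd 2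
  have hfac : (x - y) ^ 2 = (√x - √y) ^ 2 * (√x + √y) ^ 2 := by
    rw [← mul_pow]
    congr 1
    linear_combination -Real.sq_sqrt hx + Real.sq_sqrt hy0
  have hsum : (√x + √y) ^ 2 ≤ 4 * n := by
    nlinarith [sq_nonneg (√x - √y), Real.sq_sqrt hx, Real.sq_sqrt hy0]
  have h4 := mul_le_mul_of_nonneg_left hsum (sq_nonneg (√x - √y))
  have : n * (n * δ ^ 2) ≤ n * (4 * (√x - √y) ^ 2) := by nlinarith
  linarith [le_of_mul_le_mul_left this hn]

lemma eventually_log_lt_mul (K L : ℝ) {c : ℝ} (hc : 0 < c) :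
    ∀ᶠ n : ℕ in atTop, K * (Real.log (n + 1) + 1) + L < n * c := by
  have hO : (fun x : ℝ => K * Real.log x + (K + L)) =o[(atTop : Filter ℝ)] (id : ℝ → ℝ) :=
    (Real.isLittleO_log_id_atTop.const_mul_left K).add (Asymptotics.isLittleO_const_id_atTop _)
  have hev := (tendsto_atTop_add_const_right atTop (1 : ℝ) tendsto_natCast_atTop_atTop).eventually
    (hO.def (half_pos hc))
  filter_upwards [hev, eventually_gt_atTop 1] with n hn hn1
  have hn1 : (1 : ℝ) < n := by exact_mod_cast hn1
  rw [id, Real.norm_eq_abs, Real.norm_of_nonneg (by linarith)] at hn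
  nlinarith [le_abs_self (K * Real.log ((n : ℝ) + 1) + (K + L))]

end Entropy

lemma Tt_eq_visitCount (τ : ℕ → O4) : Tt τ = visitCount τ := rfl

lemma Tu_eq_visitCount (u : ℕ → ℕ × ℕ) : Tu u = visitCount u := rfl

lemma Tj_eq_visitCount (τ : ℕ → O4) (u : ℕ → ℕ × ℕ) (n : ℕ) (a : O4) (v : ℕ × ℕ) :
    Tj τ u n a v = visitCount (fun k => (τ k, u k)) n (a, v) := by
  simp [Tj, visitCount]

lemma sum_Tj_settings (τ : ℕ → O4) (u : ℕ → ℕ × ℕ) (hu : ∀ k, u k ∈ ThetaF) (n : ℕ) (a : O4) :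
    ∑ v ∈ ThetaF, Tj τ u n a v = Tt τ n a := by
  simp only [Tj, Tt, ← Finset.filter_filter]
  exact (Finset.card_eq_sum_card_fiberwise (fun k _ => hu k)).symm

lemma sum_Tj_outcomes (τ : ℕ → O4) (u : ℕ → ℕ × ℕ) (n : ℕ) (v : ℕ × ℕ) :
    ∑ a, Tj τ u n a v = Tu u n v := by
  simp only [Tj, Tu, and_comm (b := u _ = v), ← Finset.filter_filter]
  exact (Finset.card_eq_sum_card_fiberwise (fun k _ => Finset.mem_univ (τ k))).symm

/-- The closed form of the capital process in terms of factorials of the counts. -/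
lemma capital_process_eq_factorials
    (τ : ℕ → O4) (u : ℕ → ℕ × ℕ) (hu : ∀ k, u k ∈ ThetaF)
    (W : ℕ → ℝ) (hW0 : W 0 = 1)
    (hW : ∀ n, 1 ≤ n → W n = W (n - 1) *
        ((Tj τ u n (τ n) (u n) : ℝ) / n) /
        (((Tt τ n (τ n) : ℝ) / n) * ((Tu u n (u n) : ℝ) / n))) (n : ℕ) :
    W n = (n.factorial * ∏ q ∈ Finset.univ ×ˢ ThetaF, ((Tj τ u n q.1 q.2).factorial : ℝ)) /
      ((∏ a, ((Tt τ n a).factorial : ℝ)) * ∏ v ∈ ThetaF, ((Tu u n v).factorial : ℝ)) := by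
  induction n with
  | zero => simp [hW0, Tj, Tt, Tu]
  | succ n ih =>
    have hj := prod_factorial_visitCount_succ (fun k => (τ k, u k)) (Finset.univ ×ˢ ThetaF)
      (fun k => by simp [hu k]) n
    have ht := prod_factorial_visitCount_succ τ Finset.univ (fun k => Finset.mem_univ _) n
    have hu' := prod_factorial_visitCount_succ u ThetaF hu n
    have htpos := visitCount_self_pos τ n
    have hupos := visitCount_self_pos u n
    rw [hW (n + 1) (by omega), Nat.add_sub_cancel, ih, Nat.factorial_succ]
    simp only [← Nat.cast_prod, Tj_eq_visitCount, Tt_eq_visitCount, Tu_eq_visitCount, Prod.mk.eta]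
    rw [hj, ht, hu']
    push_cast
    field_simp

lemma log_capital_process_ge
    (τ : ℕ → O4) (u : ℕ → ℕ × ℕ) (hu : ∀ k, u k ∈ ThetaF)
    (W : ℕ → ℝ) (hW0 : W 0 = 1)
    (hW : ∀ n, 1 ≤ n → W n = W (n - 1) *
        ((Tj τ u n (τ n) (u n) : ℝ) / n) /
        (((Tt τ n (τ n) : ℝ) / n) * ((Tu u n (u n) : ℝ) / n)))
    {n : ℕ} (hn : 0 < n) (a : O4) {v : ℕ × ℕ} (hv : v ∈ ThetaF) :
    (√(Tj τ u n a v : ℝ) - √((Tt τ n a : ℝ) * Tu u n v / n)) ^ 2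
      - ((Finset.univ : Finset O4).card + ThetaF.card : ℝ) * (Real.log (n + 1) + 1)
      ≤ Real.log (W n) := by
  have hlogW : Real.log (W n) = Real.log n.factorial
      + ∑ a, ∑ v ∈ ThetaF, Real.log (Tj τ u n a v).factorial
      - ∑ a, Real.log (Tt τ n a).factorial - ∑ v ∈ ThetaF, Real.log (Tu u n v).factorial := by
    have hne : ∀ m : ℕ, (m.factorial : ℝ) ≠ 0 := fun m => by positivity
    rw [capital_process_eq_factorials τ u hu W hW0 hW n, Real.log_div
      (mul_ne_zero (hne _) (Finset.prod_ne_zero_iff.2 fun _ _ => hne _))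
      (mul_ne_zero (Finset.prod_ne_zero_iff.2 fun _ _ => hne _)
        (Finset.prod_ne_zero_iff.2 fun _ _ => hne _)),
      Real.log_mul (hne _) (Finset.prod_ne_zero_iff.2 fun _ _ => hne _),
      Real.log_mul (Finset.prod_ne_zero_iff.2 fun _ _ => hne _)
        (Finset.prod_ne_zero_iff.2 fun _ _ => hne _),
      Real.log_prod fun _ _ => hne _, Real.log_prod fun _ _ => hne _,
      Real.log_prod fun _ _ => hne _, Finset.sum_product]
    ring
  have hlog : ∀ m : ℕ, m ≤ n → Real.log m.factorial ≤
      (m : ℝ) * Real.log m - m + (Real.log (n + 1) + 1) := fun m hm => by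
    have : Real.log ((m : ℝ) + 1) ≤ Real.log ((n : ℝ) + 1) :=
      Real.log_le_log (by positivity) (by exact_mod_cast Nat.succ_le_succ hm)
    linarith [log_factorial_le m]
  have hr : ∀ a, ∑ v ∈ ThetaF, (Tj τ u n a v : ℝ) = Tt τ n a := fun a => by
    exact_mod_cast sum_Tj_settings τ u hu n a
  have hc : ∀ v, ∑ a, (Tj τ u n a v : ℝ) = Tu u n v := fun v => by
    exact_mod_cast sum_Tj_outcomes τ u n v
  have hrN : ∑ a, (Tt τ n a : ℝ) = n := by
    exact_mod_cast sum_visitCount τ Finset.univ (fun _ => Finset.mem_univ _) n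
  have hcN : ∑ v ∈ ThetaF, (Tu u n v : ℝ) = n := by
    exact_mod_cast sum_visitCount u ThetaF hu n
  have hinfo := sq_sqrt_sub_le_mutual_information Finset.univ ThetaF
    (fun a v => (Tj τ u n a v : ℝ)) (fun a => (Tt τ n a : ℝ)) (fun v => (Tu u n v : ℝ)) n
    (by exact_mod_cast hn) (fun _ _ _ _ => Nat.cast_nonneg _) (fun a _ => hr a) (fun v _ => hc v)
    hrN hcN (Finset.mem_univ a) hv
  have hN := mul_log_sub_le_log_factorial n
  have hJ := Finset.sum_le_sum fun (a : O4) (_ : a ∈ Finset.univ) =>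
    Finset.sum_le_sum fun v (_ : v ∈ ThetaF) => mul_log_sub_le_log_factorial (Tj τ u n a v)
  have hT := Finset.sum_le_sum fun (a : O4) (_ : a ∈ Finset.univ) =>
    hlog (Tt τ n a) (visitCount_le τ n a)
  have hU := Finset.sum_le_sum fun v (_ : v ∈ ThetaF) => hlog (Tu u n v) (visitCount_le u n v)
  simp only [Finset.sum_add_distrib, Finset.sum_sub_distrib, Finset.sum_const, nsmul_eq_mul,
    hr, hrN, hcN] at hJ hT hU
  rw [hlogW]
  linarith

/-- **Divergence of the independence-testing capital process.**
If the empirical joint distribution `P̂ₙ` on `Ω⁴ × Θ` does not asymptotically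
factorize into the product `Q̂ₙ · R̂ₙ` of its marginals, then
`limsup Wₙ = ∞` (i.e. for every `M`, frequently `M < Wₙ`). -/
theorem capital_process_W_diverges
    (τ : ℕ → O4) (u : ℕ → ℕ × ℕ) (hu : ∀ k, u k ∈ ThetaF)
    (W : ℕ → ℝ) (hW0 : W 0 = 1)
    (hW : ∀ n, 1 ≤ n → W n = W (n - 1) *
        ((Tj τ u n (τ n) (u n) : ℝ) / n) /
        (((Tt τ n (τ n) : ℝ) / n) * ((Tu u n (u n) : ℝ) / n)))
    (hdep : ¬ ∀ a : O4, ∀ v ∈ ThetaF,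
      Tendsto (fun n => (Tj τ u n a v : ℝ) / n - ((Tt τ n a : ℝ) / n) * ((Tu u n v : ℝ) / n))
        atTop (nhds 0)) :
    ∀ M : ℝ, ∃ᶠ n in atTop, M < W n := by
  intro M
  obtain ⟨a, v, hv, hnot⟩ : ∃ a, ∃ v ∈ ThetaF, ¬ Tendsto (fun n =>
      (Tj τ u n a v : ℝ) / n - ((Tt τ n a : ℝ) / n) * ((Tu u n v : ℝ) / n)) atTop (nhds 0) := by
    simpa only [not_forall, exists_prop] using hdep
  obtain ⟨δ, hδ, hfreq⟩ : ∃ δ > 0, ∃ᶠ n : ℕ in atTop,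
      δ ≤ |(Tj τ u n a v : ℝ) / n - ((Tt τ n a : ℝ) / n) * ((Tu u n v : ℝ) / n)| := by
    simpa only [Metric.tendsto_nhds, Real.dist_0_eq_abs, not_forall, exists_prop,
      not_eventually, not_lt] using hnot
  have hev := eventually_log_lt_mul ((Finset.univ : Finset O4).card + ThetaF.card)
    (Real.log (max M 1)) (c := δ ^ 2 / 4) (by positivity)
  refine (hfreq.and_eventually (hev.and (eventually_gt_atTop 0))).mono ?_
  rintro n ⟨hn, hlarge, hpos⟩
  have ht : Tt τ n a ≤ n := visitCount_le τ n a
  have hu' : Tu u n v ≤ n := visitCount_le u n v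
  have hj : Tj τ u n a v ≤ n := Tj_eq_visitCount τ u n a v ▸ visitCount_le _ n _
  have hsq := mul_sq_div_four_le_sq_sqrt_sub (Nat.cast_pos.2 hpos) hδ.le (Nat.cast_nonneg _)
    (Nat.cast_le.2 hj) (Nat.cast_nonneg _) (Nat.cast_le.2 ht)
    (Nat.cast_nonneg _) (Nat.cast_le.2 hu') hn
  have hlog := log_capital_process_ge τ u hu W hW0 hW hpos a hv
  have hWpos : 0 < W n := by
    rw [capital_process_eq_factorials τ u hu W hW0 hW n]
    positivity
  have hmax : max M 1 < W n := (Real.log_lt_log_iff (by positivity) hWpos).1 (by linarith)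
  exact (le_max_left M 1).trans_lt hmax
end

section
/- Let Λ be a set and X_s : Λ → Ω for s ∈ {1,2,3,4} functions. Let (λ_k)_{k≥1} be a sequence in Λ and (u_k)_{k≥1} = ((s_k,t_k))_{k≥1} a sequence in Θ, and set τ_k := (X_1(λ_k), X_2(λ_k), X_3(λ_k), X_4(λ_k)). Assume liminf_{n→∞} T_n(u)/n > 0 for every u ∈ Θ. Then the following two conditions cannot both hold: (1) for every (s,t) ∈ Θ and every a,b ∈ Ω, #{k ≤ n : X_s(λ_k) = a, X_t(λ_k) = b, u_k = (s,t)} / T_n((s,t)) → p(a,b|s,t) as n → ∞; (2) for every τ ∈ Ω⁴ and u ∈ Θ, P̂_n(τ;u) − Q̂_n(τ)·R̂_n(u) → 0 as n → ∞. -/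
open Filter

/-- The `s`-th coordinate of a quadruple `τ ∈ Ω⁴`, for `s ∈ {1,2,3,4}`. -/
def coord (τ : O4) : ℕ → ℤ
  | 1 => τ.1
  | 2 => τ.2.1
  | 3 => τ.2.2.1
  | 4 => τ.2.2.2
  | _ => 1

noncomputable def mu : ℝ := (2 - Real.sqrt 2) / 8
noncomputable def nu : ℝ := (2 + Real.sqrt 2) / 8

/-- The CHSH table `p(a,b|s,t)`. -/
noncomputable def chshP (a b : Sign) (s t : ℕ) : ℝ :=
  if s = 1 ∧ t = 4 then (if a = b then nu else mu) else (if a = b then mu else nu)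

theorem tendsto_div_sub_of_tendsto_sub_mul {J M R : ℕ → ℝ}
    (hR : ∀ n, 0 ≤ R n) (hpos : 0 < liminf (fun n : ℕ => R n / n) atTop)
    (h : Tendsto (fun n : ℕ => J n / n - M n / n * (R n / n)) atTop (nhds 0)) :
    Tendsto (fun n : ℕ => J n / R n - M n / n) atTop (nhds 0) := by
  obtain ⟨c, hc, hcl⟩ := exists_between hpos
  have hbdd : IsBoundedUnder (· ≥ ·) atTop (fun n : ℕ => R n / n) :=
    isBoundedUnder_of ⟨0, fun n => div_nonneg (hR n) n.cast_nonneg⟩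
  have hev : ∀ᶠ n : ℕ in atTop, c < R n / n := eventually_lt_of_lt_liminf hcl hbdd
  have habs : Tendsto (fun n : ℕ => |J n / n - M n / n * (R n / n)| / c) atTop (nhds 0) := by
    simpa using h.abs.div_const c
  refine squeeze_zero_norm' ?_ habs
  filter_upwards [hev, eventually_gt_atTop 0] with n hn hn0
  have hn0' : (0 : ℝ) < n := by exact_mod_cast hn0
  have hRpos : 0 < R n := by
    by_contra hle
    have h0 : R n = 0 := le_antisymm (not_lt.mp hle) (hR n)
    rw [h0, zero_div] at hn
    linarith
  have heq : J n / R n - M n / n = (J n / n - M n / n * (R n / n)) / (R n / n) := by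
    field_simp
  rw [heq, Real.norm_eq_abs, abs_div, abs_of_pos (hc.trans hn)]
  gcongr

theorem sum_Tj_filter (tau : ℕ → O4) (u : ℕ → ℕ × ℕ) (n : ℕ) (v : ℕ × ℕ)
    (P : O4 → Prop) [DecidablePred P] :
    ∑ a with P a, Tj tau u n a v
      = ((Finset.Icc 1 n).filter fun k => P (tau k) ∧ u k = v).card := by
  rw [Finset.card_eq_sum_card_fiberwise (f := tau) (t := Finset.univ.filter P)
    (fun k hk => by simp_all)]
  refine Finset.sum_congr rfl fun a ha => ?_
  rw [Tj, Finset.filter_filter]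
  congr 1
  ext k
  simp only [Finset.mem_filter, Finset.mem_univ, true_and] at ha ⊢
  grind

theorem sum_Tt_filter (tau : ℕ → O4) (n : ℕ) (P : O4 → Prop) [DecidablePred P] :
    ∑ a with P a, Tt tau n a = ((Finset.Icc 1 n).filter fun k => P (tau k)).card := by
  rw [Finset.card_eq_sum_card_fiberwise (f := tau) (t := Finset.univ.filter P)
    (fun k hk => by simp_all)]
  refine Finset.sum_congr rfl fun a ha => ?_
  rw [Tt, Finset.filter_filter]
  congr 1
  ext k
  simp only [Finset.mem_filter, Finset.mem_univ, true_and] at ha ⊢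
  grind

/-- Under empirical independence, the frequency of an event of `Ω⁴` conditional on a setting
pair is asymptotically its unconditional frequency. -/
theorem tendsto_conditional_sub_marginal (tau : ℕ → O4) (u : ℕ → ℕ × ℕ) (v : ℕ × ℕ)
    (hpos : 0 < liminf (fun n => (Tu u n v : ℝ) / n) atTop)
    (hind : ∀ a : O4, Tendsto (fun n =>
      (Tj tau u n a v : ℝ) / n - ((Tt tau n a : ℝ) / n) * ((Tu u n v : ℝ) / n)) atTop (nhds 0))
    (P : O4 → Prop) [DecidablePred P] :
    Tendsto (fun n =>
      (((Finset.Icc 1 n).filter fun k => P (tau k) ∧ u k = v).card : ℝ) / (Tu u n v : ℝ)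
        - (((Finset.Icc 1 n).filter fun k => P (tau k)).card : ℝ) / n) atTop (nhds 0) := by
  refine tendsto_div_sub_of_tendsto_sub_mul (fun n => Nat.cast_nonneg _) hpos ?_
  have hsum := tendsto_finsetSum (Finset.univ.filter P) fun a _ => hind a
  rw [Finset.sum_const_zero] at hsum
  refine hsum.congr fun n => ?_
  rw [Finset.sum_sub_distrib, ← Finset.sum_mul, ← Finset.sum_div, ← Finset.sum_div,
    ← sum_Tj_filter, ← sum_Tt_filter]
  push_cast
  rfl

/-- If the conditional pair frequencies of the outcomes `f` and `g` converge, then under empirical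
independence so does the unconditional frequency of agreement. -/
theorem tendsto_agreement_frequency (tau : ℕ → O4) (u : ℕ → ℕ × ℕ) (v : ℕ × ℕ)
    (hpos : 0 < liminf (fun n => (Tu u n v : ℝ) / n) atTop)
    (hind : ∀ a : O4, Tendsto (fun n =>
      (Tj tau u n a v : ℝ) / n - ((Tt tau n a : ℝ) / n) * ((Tu u n v : ℝ) / n)) atTop (nhds 0))
    (f g : O4 → Sign) (p : Sign → Sign → ℝ)
    (hp : ∀ a b : Sign, Tendsto (fun n =>
      (((Finset.Icc 1 n).filter fun k =>
        f (tau k) = a ∧ g (tau k) = b ∧ u k = v).card : ℝ) / (Tu u n v : ℝ)) atTop (nhds (p a b))) :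
    Tendsto (fun n : ℕ =>
      (((Finset.Icc 1 n).filter fun k => f (tau k) = g (tau k)).card : ℝ) / n)
      atTop (nhds (∑ a, p a a)) := by
  have hlim := (tendsto_finsetSum Finset.univ fun a _ => hp a a).sub
    (tendsto_conditional_sub_marginal tau u v hpos hind fun x => f x = g x)
  rw [sub_zero] at hlim
  refine hlim.congr fun n => ?_
  have hcard : ((Finset.Icc 1 n).filter fun k => f (tau k) = g (tau k) ∧ u k = v).card
      = ∑ a : Sign, ((Finset.Icc 1 n).filter fun k =>
          f (tau k) = a ∧ g (tau k) = a ∧ u k = v).card := by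
    rw [Finset.card_eq_sum_card_fiberwise (f := fun k => f (tau k)) (t := Finset.univ)
      (fun k _ => Finset.mem_coe.mpr (Finset.mem_univ _))]
    refine Finset.sum_congr rfl fun a _ => ?_
    rw [Finset.filter_filter]
    congr 1
    ext k
    simp only [Finset.mem_filter]
    grind
  rw [hcard, ← Finset.sum_div]
  push_cast
  ring

theorem sum_chshP_diagonal (s t : ℕ) :
    ∑ a, chshP a a s t = if s = 1 ∧ t = 4 then 2 * nu else 2 * mu := by
  have hcard : Fintype.card Sign = 2 := by decide
  simp only [chshP, if_true, Finset.sum_const, Finset.card_univ, hcard, nsmul_eq_mul,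
    Nat.cast_ofNat, mul_ite]

theorem Sign.agreement_of_agreement :
    ∀ x z y w : Sign, x = w → x = y ∨ z = y ∨ z = w := by
  decide

theorem card_agreement_le (tau : ℕ → O4) (n : ℕ) :
    ((Finset.Icc 1 n).filter fun k => (tau k).1 = (tau k).2.2.2).card ≤
      ((Finset.Icc 1 n).filter fun k => (tau k).1 = (tau k).2.2.1).card
      + ((Finset.Icc 1 n).filter fun k => (tau k).2.1 = (tau k).2.2.1).card
      + ((Finset.Icc 1 n).filter fun k => (tau k).2.1 = (tau k).2.2.2).card := by
  refine le_trans (Finset.card_le_card ?_) ((Finset.card_union_le _ _).trans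
    (Nat.add_le_add_right (Finset.card_union_le _ _) _))
  intro k hk
  simp only [Finset.mem_union, Finset.mem_filter] at hk ⊢
  have := Sign.agreement_of_agreement _ (tau k).2.1 (tau k).2.2.1 _ hk.2
  tauto

theorem six_mul_mu_lt_two_mul_nu : 2 * mu + 2 * mu + 2 * mu < 2 * nu := by
  have : (1 : ℝ) < √2 := Real.lt_sqrt_of_sq_lt (by norm_num)
  unfold mu nu
  linarith

/-- **Incompatibility of the CHSH table with empirical measurement independence.**
Let `X_s : Λ → Ω` (`s ∈ {1,2,3,4}`), `(λ_k)` a sequence in `Λ`, `(u_k) = ((s_k,t_k))`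
a sequence in `Θ`, and `τ_k := (X₁(λ_k),…,X₄(λ_k))`. If every setting pair has
positive lower density, then it cannot simultaneously hold that
(1) all conditional pair frequencies converge to the CHSH table, and
(2) the empirical joint distribution on `Ω⁴ × Θ` factorizes asymptotically. -/
theorem chsh_table_incompatible_with_empirical_independence
    {Λ : Type*} (X : ℕ → Λ → Sign) (lam : ℕ → Λ)
    (u : ℕ → ℕ × ℕ) (hu : ∀ k, u k ∈ ThetaF)
    (tau : ℕ → O4)
    (htau : ∀ k, tau k = (X 1 (lam k), X 2 (lam k), X 3 (lam k), X 4 (lam k)))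
    (hliminf : ∀ v ∈ ThetaF, 0 < liminf (fun n => (Tu u n v : ℝ) / n) atTop) :
    ¬ ((∀ s ∈ ({1, 2} : Finset ℕ), ∀ t ∈ ({3, 4} : Finset ℕ), ∀ a b : Sign,
          Tendsto (fun n =>
              (((Finset.Icc 1 n).filter fun k =>
                  X s (lam k) = a ∧ X t (lam k) = b ∧ u k = (s, t)).card : ℝ) /
                (Tu u n (s, t) : ℝ))
            atTop (nhds (chshP a b s t))) ∧
        (∀ a : O4, ∀ v ∈ ThetaF,
          Tendsto (fun n =>
              (Tj tau u n a v : ℝ) / n - ((Tt tau n a : ℝ) / n) * ((Tu u n v : ℝ) / n))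
            atTop (nhds 0))) := by
  rintro ⟨htable, hind⟩
  have hagree (s t : ℕ) (hs : s ∈ ({1, 2} : Finset ℕ)) (ht : t ∈ ({3, 4} : Finset ℕ))
      (f g : O4 → Sign) (hf : ∀ k, f (tau k) = X s (lam k)) (hg : ∀ k, g (tau k) = X t (lam k)) :
      Tendsto (fun n : ℕ =>
        (((Finset.Icc 1 n).filter fun k => f (tau k) = g (tau k)).card : ℝ) / n)
        atTop (nhds (if s = 1 ∧ t = 4 then 2 * nu else 2 * mu)) := by
    have hst : (s, t) ∈ ThetaF := Finset.mem_product.mpr ⟨hs, ht⟩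
    rw [← sum_chshP_diagonal]
    refine tendsto_agreement_frequency tau u (s, t) (hliminf _ hst) (fun a => hind a _ hst) f g
      (fun a b => chshP a b s t) fun a b => ?_
    simpa only [hf, hg] using htable s hs t ht a b
  have h14 := hagree 1 4 (by simp) (by simp) (fun x => x.1) (fun x => x.2.2.2)
    (fun k => by rw [htau]) (fun k => by rw [htau])
  have h13 := hagree 1 3 (by simp) (by simp) (fun x => x.1) (fun x => x.2.2.1)
    (fun k => by rw [htau]) (fun k => by rw [htau])
  have h23 := hagree 2 3 (by simp) (by simp) (fun x => x.2.1) (fun x => x.2.2.1)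
    (fun k => by rw [htau]) (fun k => by rw [htau])
  have h24 := hagree 2 4 (by simp) (by simp) (fun x => x.2.1) (fun x => x.2.2.2)
    (fun k => by rw [htau]) (fun k => by rw [htau])
  have hle := le_of_tendsto_of_tendsto' h14 ((h13.add h23).add h24) fun n => by
    rw [← add_div, ← add_div]
    gcongr
    exact_mod_cast card_agreement_le tau n
  norm_num at hle
  linarith [six_mul_mu_lt_two_mul_nu]
end

section
/- Let X and Y be nonempty finite sets, and let (x_k)_{k≥1} and (y_k)_{k≥1} be sequences in X and Y respectively. Define W_0 = 1 and W_n = W_{n−1} · P̂_n(x_n, y_n) / (Q̂_n(x_n) · R̂_n(y_n)). Then for every n ≥ 1, W_n = n! · ∏_{(x,y)∈X×Y} T_n(x,y)! / ( ∏_{x∈X} T_n(x)! · ∏_{y∈Y} T_n(y)! ). -/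
variable {X Y : Type*} [DecidableEq X] [DecidableEq Y]

/-- Joint count `T_n(x,y) = #{k ≤ n : x_k = x, y_k = y}`. -/
def Tjoint (x : ℕ → X) (y : ℕ → Y) (n : ℕ) (a : X) (b : Y) : ℕ :=
  ((Finset.Icc 1 n).filter fun k => x k = a ∧ y k = b).card

/-- Marginal count `T_n(x) = #{k ≤ n : x_k = x}`. -/
def Tfst (x : ℕ → X) (n : ℕ) (a : X) : ℕ :=
  ((Finset.Icc 1 n).filter fun k => x k = a).card

/-- Marginal count `T_n(y) = #{k ≤ n : y_k = y}`. -/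
def Tsnd (y : ℕ → Y) (n : ℕ) (b : Y) : ℕ :=
  ((Finset.Icc 1 n).filter fun k => y k = b).card

theorem Tfst_succ {Z : Type*} [DecidableEq Z] (z : ℕ → Z) (n : ℕ) (c : Z) :
    Tfst z (n + 1) c = if c = z (n + 1) then Tfst z n c + 1 else Tfst z n c := by
  unfold Tfst
  rw [← Finset.insert_Icc_right_eq_Icc_add_one (by omega : 1 ≤ n + 1), Finset.filter_insert]
  by_cases h : c = z (n + 1)
  · rw [if_pos h.symm, if_pos h, Finset.card_insert_of_notMem (by simp)]
  · rw [if_neg (Ne.symm h), if_neg h]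

theorem Tfst_self_pos {Z : Type*} [DecidableEq Z] (z : ℕ → Z) (n : ℕ) :
    0 < Tfst z (n + 1) (z (n + 1)) := by
  simp [Tfst_succ]

theorem prod_factorial_Tfst_succ {Z : Type*} [DecidableEq Z] [Fintype Z] (z : ℕ → Z) (n : ℕ) :
    ∏ c : Z, ((Tfst z (n + 1) c).factorial : ℝ) =
      Tfst z (n + 1) (z (n + 1)) * ∏ c : Z, ((Tfst z n c).factorial : ℝ) := by
  rw [← Finset.mul_prod_erase _ _ (Finset.mem_univ (z (n + 1))),
    ← Finset.mul_prod_erase _ (fun c => ((Tfst z n c).factorial : ℝ))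
      (Finset.mem_univ (z (n + 1))), ← mul_assoc]
  congr 1
  · simp [Tfst_succ, Nat.factorial_succ]
  · refine Finset.prod_congr rfl fun c hc => ?_
    rw [Tfst_succ, if_neg (Finset.ne_of_mem_erase hc)]

theorem Tjoint_eq_Tfst_prodMk (x : ℕ → X) (y : ℕ → Y) (n : ℕ) (a : X) (b : Y) :
    Tjoint x y n a b = Tfst (fun k => (x k, y k)) n (a, b) := by
  simp [Tjoint, Tfst]

theorem Tsnd_eq_Tfst (y : ℕ → Y) : Tsnd y = Tfst y := rfl

theorem prod_factorial_Tjoint [Fintype X] [Fintype Y] (x : ℕ → X) (y : ℕ → Y) (n : ℕ) :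
    ∏ a : X, ∏ b : Y, ((Tjoint x y n a b).factorial : ℝ) =
      ∏ c : X × Y, ((Tfst (fun k => (x k, y k)) n c).factorial : ℝ) := by
  simp only [Tjoint_eq_Tfst_prodMk, Fintype.prod_prod_type]

/-- **Closed form of the independence-testing capital process.**
With `W₀ = 1` and `Wₙ = Wₙ₋₁ · P̂ₙ(xₙ,yₙ) / (Q̂ₙ(xₙ)·R̂ₙ(yₙ))`, one has for every
`n ≥ 1`:  `Wₙ = n! · ∏_{(x,y)} T_n(x,y)! / (∏_x T_n(x)! · ∏_y T_n(y)!)`. -/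
theorem capital_process_factorial_formula
    [Fintype X] [Fintype Y] [Nonempty X] [Nonempty Y]
    (x : ℕ → X) (y : ℕ → Y) (W : ℕ → ℝ) (hW0 : W 0 = 1)
    (hW : ∀ n, 1 ≤ n → W n = W (n - 1) *
        ((Tjoint x y n (x n) (y n) : ℝ) / n) /
        (((Tfst x n (x n) : ℝ) / n) * ((Tsnd y n (y n) : ℝ) / n))) :
    ∀ n, 1 ≤ n → W n =
      ((n.factorial : ℝ) * ∏ a : X, ∏ b : Y, ((Tjoint x y n a b).factorial : ℝ)) /
      ((∏ a : X, ((Tfst x n a).factorial : ℝ)) * ∏ b : Y, ((Tsnd y n b).factorial : ℝ)) := by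
  suffices h : ∀ n, W n =
      ((n.factorial : ℝ) * ∏ a : X, ∏ b : Y, ((Tjoint x y n a b).factorial : ℝ)) /
      ((∏ a : X, ((Tfst x n a).factorial : ℝ)) * ∏ b : Y, ((Tsnd y n b).factorial : ℝ)) from
    fun n _ => h n
  intro n
  induction n with
  | zero => simp [hW0, Tjoint, Tfst, Tsnd]
  | succ n ih =>
    have hn : ((n + 1 : ℕ) : ℝ) ≠ 0 := by positivity
    have hx : (Tfst x (n + 1) (x (n + 1)) : ℝ) ≠ 0 := by exact_mod_cast (Tfst_self_pos x n).ne'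
    have hy : (Tfst y (n + 1) (y (n + 1)) : ℝ) ≠ 0 := by exact_mod_cast (Tfst_self_pos y n).ne'
    have hpx : ∏ a : X, ((Tfst x n a).factorial : ℝ) ≠ 0 :=
      Finset.prod_ne_zero_iff.2 fun _ _ => by positivity
    have hpy : ∏ b : Y, ((Tfst y n b).factorial : ℝ) ≠ 0 :=
      Finset.prod_ne_zero_iff.2 fun _ _ => by positivity
    rw [hW (n + 1) (by omega), Nat.add_sub_cancel, ih]
    rw [prod_factorial_Tjoint, prod_factorial_Tjoint]
    simp only [Tsnd_eq_Tfst, Tjoint_eq_Tfst_prodMk, prod_factorial_Tfst_succ,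
      Nat.factorial_succ, Nat.cast_mul]
    field_simp
end

section
/- Let (τ_k)_{k≥1} be a sequence in Ω⁴ and (u_k)_{k≥1} = ((s_k,t_k))_{k≥1} a sequence in Θ. Assume liminf_{n→∞} R̂_n(u) > 0 for every u ∈ Θ, and that for every τ ∈ Ω⁴ and u ∈ Θ, P̂_n(τ;u) − Q̂_n(τ)·R̂_n(u) → 0 as n → ∞. Then for every (s,t) ∈ Θ and every a,b ∈ Ω, S_n(a,b)/n − S_n(a,b;s,t)/T_n((s,t)) → 0 as n → ∞, where S_n(a,b) := #{k ≤ n : τ_k^s = a, τ_k^t = b} and S_n(a,b;s,t) := #{k ≤ n : τ_k^s = a, τ_k^t = b, u_k = (s,t)} (τ_k^s denotes the s-th coordinate of τ_k). -/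
open Filter

/-- `S_n(a,b) = #{k ≤ n : τ_kˢ = a, τ_kᵗ = b}`. -/
def Spair (τ : ℕ → O4) (n : ℕ) (s t : ℕ) (a b : Sign) : ℕ :=
  ((Finset.Icc 1 n).filter fun k => coord (τ k) s = (a : ℤ) ∧ coord (τ k) t = (b : ℤ)).card

/-- `S_n(a,b; s,t) = #{k ≤ n : τ_kˢ = a, τ_kᵗ = b, u_k = (s,t)}`. -/
def SpairSet (τ : ℕ → O4) (u : ℕ → ℕ × ℕ) (n : ℕ) (s t : ℕ) (a b : Sign) : ℕ :=
  ((Finset.Icc 1 n).filter fun k =>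
    coord (τ k) s = (a : ℤ) ∧ coord (τ k) t = (b : ℤ) ∧ u k = (s, t)).card

/-- A count over indices with a property of `τ k` splits as a sum over the values of `τ`. -/
theorem card_filter_comp_eq_sum {α : Type*} [Fintype α] [DecidableEq α] (I : Finset ℕ)
    (τ : ℕ → α) (p : α → Prop) [DecidablePred p] (q : ℕ → Prop) [DecidablePred q] :
    (I.filter fun k => p (τ k) ∧ q k).card =
      ∑ c ∈ Finset.univ.filter p, (I.filter fun k => τ k = c ∧ q k).card := by
  rw [Finset.card_eq_sum_card_fiberwise (f := τ) (t := Finset.univ.filter p)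
    (fun k hk => by simp_all)]
  refine Finset.sum_congr rfl fun c hc => congrArg Finset.card ?_
  ext k
  simp only [Finset.mem_filter, Finset.mem_univ, true_and] at hc ⊢
  constructor
  · rintro ⟨⟨hk, -, hq⟩, h⟩
    exact ⟨hk, h, hq⟩
  · rintro ⟨hk, rfl, hq⟩
    exact ⟨⟨hk, hc, hq⟩, rfl⟩

theorem Spair_eq_sum (τ : ℕ → O4) (n s t : ℕ) (a b : Sign) :
    Spair τ n s t a b =
      ∑ c ∈ Finset.univ.filter fun c : O4 => coord c s = (a : ℤ) ∧ coord c t = (b : ℤ),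
        Tt τ n c := by
  simpa [Spair, Tt] using card_filter_comp_eq_sum (Finset.Icc 1 n) τ
    (fun c : O4 => coord c s = (a : ℤ) ∧ coord c t = (b : ℤ)) (fun _ => True)

theorem SpairSet_eq_sum (τ : ℕ → O4) (u : ℕ → ℕ × ℕ) (n s t : ℕ) (a b : Sign) :
    SpairSet τ u n s t a b =
      ∑ c ∈ Finset.univ.filter fun c : O4 => coord c s = (a : ℤ) ∧ coord c t = (b : ℤ),
        Tj τ u n c (s, t) := by
  simpa only [SpairSet, Tj, and_assoc] using card_filter_comp_eq_sum (Finset.Icc 1 n) τ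
    (fun c : O4 => coord c s = (a : ℤ) ∧ coord c t = (b : ℤ)) (fun k => u k = (s, t))

/-- A null sequence divided by a sequence with positive lower limit is null. -/
theorem tendsto_div_zero_of_liminf_pos {f r : ℕ → ℝ} (hf : Tendsto f atTop (nhds 0))
    (hr : ∀ n, 0 ≤ r n) (hpos : 0 < liminf r atTop) :
    Tendsto (fun n => f n / r n) atTop (nhds 0) := by
  obtain ⟨c, hc, hcl⟩ := exists_between hpos
  have hev : ∀ᶠ n in atTop, c < r n :=
    eventually_lt_of_lt_liminf hcl (isBoundedUnder_of ⟨0, hr⟩)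
  have hbound : Tendsto (fun n => |f n| / c) atTop (nhds 0) := by
    simpa using hf.abs.div_const c
  refine squeeze_zero_norm' ?_ hbound
  filter_upwards [hev] with n hn
  rw [Real.norm_eq_abs, abs_div, abs_of_pos (hc.trans hn)]
  gcongr

/-- **From empirical factorization to pairwise conditional frequencies.**
If every setting pair has positive lower density and the empirical joint
distribution on `Ω⁴ × Θ` factorizes asymptotically, then for every `(s,t) ∈ Θ` and
all `a, b ∈ Ω`, `S_n(a,b)/n − S_n(a,b;s,t)/T_n((s,t)) → 0`. -/
theorem empirical_independence_gives_pair_frequencies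
    (τ : ℕ → O4) (u : ℕ → ℕ × ℕ) (hu : ∀ k, u k ∈ ThetaF)
    (hliminf : ∀ v ∈ ThetaF, 0 < liminf (fun n => (Tu u n v : ℝ) / n) atTop)
    (hindep : ∀ a : O4, ∀ v ∈ ThetaF,
      Tendsto (fun n => (Tj τ u n a v : ℝ) / n - ((Tt τ n a : ℝ) / n) * ((Tu u n v : ℝ) / n))
        atTop (nhds 0)) :
    ∀ s ∈ ({1, 2} : Finset ℕ), ∀ t ∈ ({3, 4} : Finset ℕ), ∀ a b : Sign,
      Tendsto (fun n => (Spair τ n s t a b : ℝ) / n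
          - (SpairSet τ u n s t a b : ℝ) / (Tu u n (s, t) : ℝ))
        atTop (nhds 0) := by
  intro s hs t ht a b
  have hv : (s, t) ∈ ThetaF := Finset.mem_product.2 ⟨hs, ht⟩
  have hD : Tendsto (fun n => (Spair τ n s t a b : ℝ) / n * ((Tu u n (s, t) : ℝ) / n)
      - (SpairSet τ u n s t a b : ℝ) / n) atTop (nhds 0) := by
    have h := (tendsto_finsetSum
      (Finset.univ.filter fun c : O4 => coord c s = (a : ℤ) ∧ coord c t = (b : ℤ))
      fun c _ => hindep c (s, t) hv).neg
    simp only [Finset.sum_const_zero, neg_zero] at h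
    refine h.congr fun n => ?_
    rw [Spair_eq_sum, SpairSet_eq_sum, Finset.sum_sub_distrib, ← Finset.sum_mul,
      ← Finset.sum_div, ← Finset.sum_div]
    push_cast
    ring
  refine (tendsto_div_zero_of_liminf_pos hD (fun n => by positivity)
    (hliminf (s, t) hv)).congr' ?_
  have hev := eventually_lt_of_lt_liminf (hliminf (s, t) hv)
    (isBoundedUnder_of ⟨0, fun n => by positivity⟩)
  filter_upwards [hev, eventually_gt_atTop 0] with n hn hn0
  have hn' : (n : ℝ) ≠ 0 := by positivity
  have hT : (Tu u n (s, t) : ℝ) ≠ 0 := fun h => by simp [h] at hn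
  field_simp
end

section
/- Let (Λ, F, P) be a probability space and let X_1, X_2, X_3, X_4 : Λ → ℝ be random variables (measurable functions) with |X_s| ≤ 1 almost surely for each s ∈ {1,2,3,4}. Define C(s,t) := E[X_s · X_t]. Then | C(1,3) − C(1,4) + C(2,3) + C(2,4) | ≤ 2. -/
open MeasureTheory

/-- The pointwise CHSH bound for real numbers in `[-1, 1]`. -/
lemma abs_chsh_le_two {a b c d : ℝ} (ha : |a| ≤ 1) (hb : |b| ≤ 1) (hc : |c| ≤ 1) (hd : |d| ≤ 1) :
    |a * c - a * d + b * c + b * d| ≤ 2 := by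
  calc |a * c - a * d + b * c + b * d| = |a * (c - d) + b * (c + d)| := by ring_nf
    _ ≤ |a| * |c - d| + |b| * |c + d| := by
      simpa only [abs_mul] using abs_add_le (a * (c - d)) (b * (c + d))
    _ ≤ 1 * |c - d| + 1 * |c + d| := by gcongr
    _ ≤ 2 := by
      rw [abs_le] at hc hd
      rcases abs_cases (c - d) with h | h <;> rcases abs_cases (c + d) with h' | h' <;> linarith

/-- The product of two almost surely bounded random variables is integrable. -/
lemma integrable_mul_of_ae_abs_le_one {Ω : Type*} [MeasurableSpace Ω] {μ : Measure Ω}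
    [IsFiniteMeasure μ] {f g : Ω → ℝ} (hf : AEStronglyMeasurable f μ)
    (hg : AEStronglyMeasurable g μ) (hf1 : ∀ᵐ x ∂μ, |f x| ≤ 1) (hg1 : ∀ᵐ x ∂μ, |g x| ≤ 1) :
    Integrable (fun x => f x * g x) μ :=
  (Integrable.of_bound hg 1 hg1).bdd_mul hf hf1

/-- **CHSH inequality, measure-theoretic form.**
If `X₁, X₂, X₃, X₄ : Λ → ℝ` are random variables on a probability space `(Λ, F, P)`
with `|Xₛ| ≤ 1` almost surely, and `C(s,t) := E[Xₛ·Xₜ]`, then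
`|C(1,3) − C(1,4) + C(2,3) + C(2,4)| ≤ 2`. -/
theorem chsh_inequality
    {Λ : Type*} [MeasurableSpace Λ] (P : Measure Λ) [IsProbabilityMeasure P]
    (X : ℕ → Λ → ℝ)
    (hmeas : ∀ s ∈ ({1, 2, 3, 4} : Finset ℕ), Measurable (X s))
    (hbdd : ∀ s ∈ ({1, 2, 3, 4} : Finset ℕ), ∀ᵐ l ∂P, |X s l| ≤ 1) :
    |(∫ l, X 1 l * X 3 l ∂P) - (∫ l, X 1 l * X 4 l ∂P)
      + (∫ l, X 2 l * X 3 l ∂P) + (∫ l, X 2 l * X 4 l ∂P)| ≤ 2 := by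
  have hint : ∀ s ∈ ({1, 2, 3, 4} : Finset ℕ), ∀ t ∈ ({1, 2, 3, 4} : Finset ℕ),
      Integrable (fun l => X s l * X t l) P := fun s hs t ht =>
    integrable_mul_of_ae_abs_le_one (hmeas s hs).aestronglyMeasurable
      (hmeas t ht).aestronglyMeasurable (hbdd s hs) (hbdd t ht)
  have h13 := hint 1 (by simp) 3 (by simp)
  have h14 := hint 1 (by simp) 4 (by simp)
  have h23 := hint 2 (by simp) 3 (by simp)
  have h24 := hint 2 (by simp) 4 (by simp)
  rw [← integral_sub' h13 h14, ← integral_add' (h13.sub h14) h23,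
    ← integral_add' ((h13.sub h14).add h23) h24]
  have hbound : ∀ᵐ l ∂P,
      ‖X 1 l * X 3 l - X 1 l * X 4 l + X 2 l * X 3 l + X 2 l * X 4 l‖ ≤ 2 := by
    filter_upwards [hbdd 1 (by simp), hbdd 2 (by simp), hbdd 3 (by simp), hbdd 4 (by simp)]
      with l h1 h2 h3 h4
    exact abs_chsh_le_two h1 h2 h3 h4
  simpa using norm_integral_le_of_norm_le_const hbound
end

section
/- Consider the following game: at each round n, Skeptic announces a family of bets {q_n(·|s) ∈ P(Ω)}_{s∈S} and a setting s_n ∈ S (both as functions of the past history), and then Reality announces ω_n ∈ Ω; the capital is K_0 = 1, K_n = K_{n−1} · q_n(ω_n|s_n) / p(ω_n|s_n). Then Skeptic has a strategy under which every setting s ∈ S is chosen infinitely often, and such that for every sequence of Reality's moves ω : ℕ≥1 → Ω, either K_n → ∞ as n → ∞, or for every s ∈ S and every a ∈ Ω, #{i ≤ n : ω_i = a, s_i = s} / #{i ≤ n : s_i = s} → p(a|s) as n → ∞. -/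
open Filter

/-- The history `ω₁ ⋯ ω_m` of Reality's first `m` moves, as a list. -/
def hist {Ω : Type*} (ω : ℕ → Ω) (m : ℕ) : List Ω :=
  (List.range m).map fun i => ω (i + 1)

theorem hist_succ {Ω : Type*} (ω : ℕ → Ω) (m : ℕ) :
    hist ω (m + 1) = hist ω m ++ [ω (m + 1)] := by
  simp [hist, List.range_succ]

theorem length_hist {Ω : Type*} (ω : ℕ → Ω) (m : ℕ) : (hist ω m).length = m := by
  simp [hist]

/-- The pair (active capital, saved capital) obtained from a betting scheme with return `f t a` on
outcome `a` after the reversed history `t`, where all active capital above `1` is put aside. -/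
noncomputable def savings {Ω : Type*} (f : List Ω → Ω → ℝ) : List Ω → ℝ × ℝ
  | [] => (1, 0)
  | a :: t =>
    (min ((savings f t).1 * f t a) 1,
      (savings f t).2 + ((savings f t).1 * f t a - min ((savings f t).1 * f t a) 1))

section Savings

variable {Ω : Type*} {f : List Ω → Ω → ℝ}

theorem savings_fst_pos (hf : ∀ t a, 0 < f t a) (t : List Ω) : 0 < (savings f t).1 := by
  induction t with
  | nil => simp [savings]
  | cons a t ih => exact lt_min (mul_pos ih (hf t a)) one_pos

theorem savings_fst_le_one (t : List Ω) : (savings f t).1 ≤ 1 := by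
  cases t with
  | nil => simp [savings]
  | cons a t => exact min_le_right _ _

theorem savings_snd_le_cons (a : Ω) (t : List Ω) : (savings f t).2 ≤ (savings f (a :: t)).2 := by
  have := min_le_left ((savings f t).1 * f t a) 1
  simp only [savings]
  linarith

theorem savings_snd_nonneg (t : List Ω) : 0 ≤ (savings f t).2 := by
  induction t with
  | nil => simp [savings]
  | cons a t ih => exact ih.trans (savings_snd_le_cons a t)

theorem savings_total_cons (a : Ω) (t : List Ω) :
    (savings f (a :: t)).1 + (savings f (a :: t)).2
      = (savings f t).1 * f t a + (savings f t).2 := by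
  simp only [savings]
  ring

theorem savings_total_le (hf : ∀ t a, 0 < f t a) (hf2 : ∀ t a, f t a ≤ 2) (t : List Ω) :
    (savings f t).1 + (savings f t).2 ≤ 2 ^ t.length := by
  induction t with
  | nil => simp [savings]
  | cons a t ih =>
    rw [savings_total_cons, List.length_cons, pow_succ]
    nlinarith [mul_le_mul_of_nonneg_left (hf2 t a) (savings_fst_pos hf t).le,
      savings_snd_nonneg (f := f) t]

theorem savings_log_growth (hf : ∀ t a, 0 < f t a) (a : Ω) (t : List Ω) :
    Real.log (savings f t).1 + (savings f t).2 + Real.log (f t a)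
      ≤ Real.log (savings f (a :: t)).1 + (savings f (a :: t)).2 := by
  have hA := savings_fst_pos hf t
  have hx := mul_pos hA (hf t a)
  have hlog := Real.log_mul hA.ne' (hf t a).ne'
  simp only [savings]
  rcases le_total ((savings f t).1 * f t a) 1 with h | h
  · rw [min_eq_left h]
    linarith
  · rw [min_eq_right h, Real.log_one]
    linarith [Real.log_le_sub_one_of_pos hx]

end Savings

theorem sub_two_mul_sq_le_log_one_add {x : ℝ} (hx : -(1 / 2) ≤ x) :
    x - 2 * x ^ 2 ≤ Real.log (1 + x) := by
  have h : 0 < 1 + x := by linarith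
  refine le_trans ?_ (Real.one_sub_inv_le_log_of_pos h)
  rw [← sub_nonneg]
  have : 1 - (1 + x)⁻¹ - (x - 2 * x ^ 2) = x ^ 2 * (1 + 2 * x) / (1 + x) := by
    field_simp
    ring
  rw [this]
  have : 0 ≤ 1 + 2 * x := by linarith
  positivity

/-- The return of the bet of signed size `ε` on the outcome `a` in the rounds with setting `s`,
after the reversed history `t`. -/
noncomputable def signedBet {Ω S : Type*} [DecidableEq Ω] [DecidableEq S] (p : S → Ω → ℝ)
    (σ : ℕ → S) (s : S) (a : Ω) (ε : ℝ) (t : List Ω) (b : Ω) : ℝ :=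
  if σ t.length = s then 1 + ε * ((if b = a then 1 else 0) - p s a) else 1

section SignedBet

variable {Ω S : Type*} [DecidableEq Ω] [DecidableEq S] {p : S → Ω → ℝ} {σ : ℕ → S} {ε : ℝ}

theorem abs_mul_indicator_sub_le {q : ℝ} (hq : q ∈ Set.Ioo (0 : ℝ) 1) (P : Prop) [Decidable P] :
    |ε * ((if P then 1 else 0) - q)| ≤ |ε| := by
  rw [abs_mul]
  refine mul_le_of_le_one_right (abs_nonneg _) ?_
  obtain ⟨h0, h1⟩ := hq
  rw [abs_le]
  split_ifs <;> constructor <;> linarith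

theorem signedBet_pos (hp : ∀ s a, p s a ∈ Set.Ioo (0 : ℝ) 1) (hε : |ε| ≤ 1 / 2) (s : S) (a : Ω)
    (t : List Ω) (b : Ω) : 0 < signedBet p σ s a ε t b := by
  have := abs_le.1 ((abs_mul_indicator_sub_le (ε := ε) (hp s a) (b = a)).trans hε)
  unfold signedBet
  split_ifs at this ⊢ <;> linarith

theorem signedBet_le_two (hp : ∀ s a, p s a ∈ Set.Ioo (0 : ℝ) 1) (hε : |ε| ≤ 1 / 2) (s : S)
    (a : Ω) (t : List Ω) (b : Ω) : signedBet p σ s a ε t b ≤ 2 := by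
  have := abs_le.1 ((abs_mul_indicator_sub_le (ε := ε) (hp s a) (b = a)).trans hε)
  unfold signedBet
  split_ifs at this ⊢ <;> linarith

theorem sum_mul_signedBet [Fintype Ω] (hpsum : ∀ s, ∑ a, p s a = 1) (s : S) (a : Ω)
    (t : List Ω) : ∑ b, p (σ t.length) b * signedBet p σ s a ε t b = 1 := by
  unfold signedBet
  split_ifs with h
  · rw [h]
    have : ∀ b, p s b * (1 + ε * ((if b = a then 1 else 0) - p s a))
        = p s b * (1 - ε * p s a) + ε * (if b = a then p s b else 0) := by
      intro b
      split_ifs <;> ring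
    simp only [this, Finset.sum_add_distrib, ← Finset.sum_mul, ← Finset.mul_sum, hpsum]
    simp
  · simp [hpsum]

theorem le_log_signedBet (hp : ∀ s a, p s a ∈ Set.Ioo (0 : ℝ) 1) (hε : |ε| ≤ 1 / 2) (s : S)
    (a : Ω) (t : List Ω) (b : Ω) :
    ε * ((if b = a ∧ σ t.length = s then 1 else 0) - p s a * (if σ t.length = s then 1 else 0))
        - 2 * ε ^ 2 * (if σ t.length = s then 1 else 0)
      ≤ Real.log (signedBet p σ s a ε t b) := by
  have hx := abs_mul_indicator_sub_le (ε := ε) (hp s a) (b = a)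
  unfold signedBet
  by_cases h : σ t.length = s
  · simp only [h, and_true, if_true, mul_one]
    have h1 := sub_two_mul_sq_le_log_one_add (abs_le.1 (hx.trans hε)).1
    have h2 := sq_le_sq.2 hx
    linarith
  · simp [h]

theorem le_savings_signedBet (hp : ∀ s a, p s a ∈ Set.Ioo (0 : ℝ) 1) (hε : |ε| ≤ 1 / 2) (s : S)
    (a : Ω) (ω : ℕ → Ω) (setting : ℕ → S) (hset : ∀ n, setting (n + 1) = σ n) (n : ℕ) :
    ε * ((((Finset.Icc 1 n).filter fun i => ω i = a ∧ setting i = s).card : ℝ)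
        - p s a * ((Finset.Icc 1 n).filter fun i => setting i = s).card)
        - 2 * ε ^ 2 * ((Finset.Icc 1 n).filter fun i => setting i = s).card
      ≤ (savings (signedBet p σ s a ε) (hist ω n).reverse).2 := by
  have hf : ∀ t b, 0 < signedBet p σ s a ε t b := signedBet_pos hp hε s a
  suffices h : ε * ((((Finset.Icc 1 n).filter fun i => ω i = a ∧ setting i = s).card : ℝ)
        - p s a * ((Finset.Icc 1 n).filter fun i => setting i = s).card)
        - 2 * ε ^ 2 * ((Finset.Icc 1 n).filter fun i => setting i = s).card
      ≤ Real.log (savings (signedBet p σ s a ε) (hist ω n).reverse).1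
        + (savings (signedBet p σ s a ε) (hist ω n).reverse).2 by
    linarith [Real.log_nonpos (savings_fst_pos hf (hist ω n).reverse).le (savings_fst_le_one _)]
  simp only [Finset.card_filter, Nat.cast_sum, Nat.cast_ite, Nat.cast_one, Nat.cast_zero]
  induction n with
  | zero => simp [hist, savings]
  | succ n ih =>
    have hlog := le_log_signedBet (σ := σ) hp hε s a (hist ω n).reverse (ω (n + 1))
    have hgrow := savings_log_growth hf (ω (n + 1)) (hist ω n).reverse
    rw [List.length_reverse, length_hist] at hlog
    rw [hist_succ, List.reverse_append, List.reverse_singleton, List.singleton_append,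
      Finset.sum_Icc_succ_top (by omega), Finset.sum_Icc_succ_top (by omega), hset]
    linarith

end SignedBet

theorem tendsto_div_of_forall_mul_sub_le {x N : ℕ → ℝ} {q : ℝ} (hN : Tendsto N atTop atTop)
    (h : ∀ k : ℕ, ∀ ε : ℝ, |ε| = 1 / (k + 2) →
      ∃ B, ∀ n, ε * (x n - q * N n) - 2 * ε ^ 2 * N n ≤ B) :
    Tendsto (fun n => x n / N n) atTop (nhds q) := by
  rw [Metric.tendsto_nhds]
  intro δ hδ
  obtain ⟨k, hk⟩ := exists_nat_gt (3 / δ)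
  have hε : (0 : ℝ) < 1 / (k + 2) := by positivity
  have hεδ : 3 * (1 / ((k : ℝ) + 2)) < δ := by
    rw [div_lt_iff₀ hδ] at hk
    rw [mul_one_div, div_lt_iff₀ (by positivity)]
    nlinarith
  obtain ⟨B, hB⟩ := h k _ (abs_of_pos hε)
  obtain ⟨B', hB'⟩ := h k (-(1 / (k + 2))) (by rw [abs_neg, abs_of_pos hε])
  generalize 1 / ((k : ℝ) + 2) = ε at *
  filter_upwards [hN.eventually_gt_atTop 0, hN.eventually_gt_atTop (B / ε ^ 2),
    hN.eventually_gt_atTop (B' / ε ^ 2)] with n h0 h1 h2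
  rw [div_lt_iff₀ (by positivity)] at h1 h2
  have hn := hB n
  have hn' := hB' n
  have hle : |x n - q * N n| ≤ 3 * ε * N n := by
    rw [abs_le]
    constructor <;> refine le_of_mul_le_mul_left ?_ hε <;> nlinarith
  have : x n / N n - q = (x n - q * N n) / N n := by field_simp
  rw [Real.dist_eq, this, abs_div, abs_of_pos h0]
  exact ((div_le_iff₀ h0).2 hle).trans_lt hεδ

theorem tendsto_card_filter_atTop {S : Type*} [DecidableEq S] {setting : ℕ → S} {s : S}
    (h : ∀ N, ∃ n ≥ N, 1 ≤ n ∧ setting n = s) :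
    Tendsto (fun n => (((Finset.Icc 1 n).filter fun i => setting i = s).card : ℝ))
      atTop atTop := by
  refine tendsto_natCast_atTop_atTop.comp (tendsto_atTop_atTop_of_monotone ?_ ?_)
  · intro m n hmn
    exact Finset.card_le_card (Finset.filter_subset_filter _ (Finset.Icc_subset_Icc_right hmn))
  · intro b
    induction b with
    | zero => exact ⟨0, Nat.zero_le _⟩
    | succ b ih =>
      obtain ⟨m, hm⟩ := ih
      obtain ⟨n, hn, h1, hs⟩ := h (m + 1)
      refine ⟨n, Nat.succ_le_of_lt (hm.trans_lt (Finset.card_lt_card ?_))⟩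
      refine Finset.ssubset_iff_of_subset
        (Finset.filter_subset_filter _ (Finset.Icc_subset_Icc_right (by omega))) |>.2
        ⟨n, by simp [h1, hs], by simp; omega⟩

/-- A positive martingale, on histories in which round `n + 1` has setting `σ n`, that forces the
convergence of all conditional frequencies. -/
theorem exists_forcing_martingale
    {Ω S : Type*} [Fintype Ω] [Nonempty Ω] [DecidableEq Ω]
    [Fintype S] [Nonempty S] [DecidableEq S]
    {p : S → Ω → ℝ} (hp : ∀ s a, p s a ∈ Set.Ioo (0 : ℝ) 1)
    (hpsum : ∀ s, ∑ a, p s a = 1) (σ : ℕ → S) :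
    ∃ C : List Ω → ℝ, C [] = 1 ∧ (∀ h, 0 < C h) ∧
      (∀ h, ∑ a, p (σ h.length) a * C (h ++ [a]) = C h) ∧
      ∀ ω : ℕ → Ω, ∀ setting : ℕ → S, (∀ n, setting (n + 1) = σ n) →
        (∀ s : S, ∀ N, ∃ n ≥ N, 1 ≤ n ∧ setting n = s) →
        (Tendsto (fun n => C (hist ω n)) atTop atTop ∨
          ∀ s a, Tendsto
            (fun n => (((Finset.Icc 1 n).filter fun i => ω i = a ∧ setting i = s).card : ℝ) /
              (((Finset.Icc 1 n).filter fun i => setting i = s).card : ℝ))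
            atTop (nhds (p s a))) := by
  let _ : Encodable S := Fintype.toEncodable S
  let _ : Encodable Ω := Fintype.toEncodable Ω
  let size : Bool × ℕ → ℝ := fun b => (if b.1 then 1 else -1) * (1 / (b.2 + 2))
  have hsize : ∀ b, |size b| ≤ 1 / 2 := by
    rintro ⟨b, k⟩
    have : (1 : ℝ) / (k + 2) ≤ 1 / 2 := by gcongr; linarith [k.cast_nonneg (α := ℝ)]
    have h0 : (0 : ℝ) ≤ 1 / (k + 2) := by positivity
    cases b <;> simp only [size, abs_mul, abs_of_nonneg h0] <;> simpa using this
  let f : (S × Ω) × Bool × ℕ → List Ω → Ω → ℝ := fun j => signedBet p σ j.1.1 j.1.2 (size j.2)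
  have hf : ∀ j t a, 0 < f j t a := fun j => signedBet_pos hp (hsize _) _ _
  let L : (S × Ω) × Bool × ℕ → List Ω → ℝ := fun j t => (savings (f j) t).1 + (savings (f j) t).2
  have hLpos : ∀ j t, 0 < L j t := fun j t =>
    add_pos_of_pos_of_nonneg (savings_fst_pos (hf j) t) (savings_snd_nonneg t)
  have hLle : ∀ j t, L j t ≤ 2 ^ t.length := fun j t =>
    savings_total_le (hf j) (signedBet_le_two hp (hsize _) _ _) t
  have hLmart : ∀ j t, ∑ a, p (σ t.length) a * L j (a :: t) = L j t := by
    intro j t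
    have hsum : ∑ a, p (σ t.length) a * f j t a = 1 := sum_mul_signedBet hpsum _ _ t
    calc ∑ a, p (σ t.length) a * L j (a :: t)
        = ∑ a, ((savings (f j) t).1 * (p (σ t.length) a * f j t a)
            + p (σ t.length) a * (savings (f j) t).2) :=
          Finset.sum_congr rfl fun a _ => by simp only [L, savings_total_cons]; ring
      _ = L j t := by
          rw [Finset.sum_add_distrib, ← Finset.mul_sum, ← Finset.sum_mul, hsum, hpsum]
          simp [L]
  obtain ⟨w, hw, c, hwc, -⟩ := posSumOfEncodable one_pos ((S × Ω) × Bool × ℕ)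
  have hsummable : ∀ t, Summable fun j => w j * L j t := fun t =>
    Summable.of_nonneg_of_le (fun j => (mul_pos (hw j) (hLpos j t)).le)
      (fun j => mul_le_mul_of_nonneg_left (hLle j t) (hw j).le) (hwc.summable.mul_right _)
  have hle_tsum : ∀ j t, w j * L j t ≤ ∑' i, w i * L i t := fun j t =>
    (hsummable t).le_tsum j fun i _ => (mul_pos (hw i) (hLpos i t)).le
  let j₀ : (S × Ω) × Bool × ℕ := Classical.arbitrary _
  have hc : 0 < c := (hw j₀).trans_le (le_hasSum hwc j₀ fun i _ => (hw i).le)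
  refine ⟨fun h => (∑' j, w j * L j h.reverse) / c, ?_, ?_, ?_, ?_⟩
  · simp [L, savings, hwc.tsum_eq, hc.ne']
  · exact fun h => div_pos ((mul_pos (hw j₀) (hLpos j₀ _)).trans_le (hle_tsum j₀ _)) hc
  · intro h
    simp only [List.reverse_append, List.reverse_singleton, List.singleton_append, mul_div_assoc',
      ← Finset.sum_div, ← tsum_mul_left]
    rw [← Summable.tsum_finsetSum fun a _ => (hsummable _).mul_left _]
    congr 2 with j
    rw [← hLmart j h.reverse, Finset.mul_sum, List.length_reverse]
    exact Finset.sum_congr rfl fun a _ => by ring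
  · intro ω setting hset hinf
    rw [or_iff_not_imp_left]
    intro hC s a
    refine tendsto_div_of_forall_mul_sub_le (tendsto_card_filter_atTop (hinf s)) ?_
    intro k ε hε
    obtain ⟨b, hb⟩ : ∃ b, size (b, k) = ε := by
      have h0 : (0 : ℝ) ≤ 1 / (k + 2) := by positivity
      rcases (abs_eq h0).1 hε with h | h
      · exact ⟨true, by simp [size, h]⟩
      · exact ⟨false, by simp [size, h]⟩
    let j : (S × Ω) × Bool × ℕ := ((s, a), (b, k))
    by_contra! hunb
    refine hC (tendsto_atTop_mono (fun n => ?_)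
      ((Tendsto.const_mul_atTop (hw j) (f := fun n => (savings (f j) (hist ω n).reverse).2)
        ?_).atTop_div_const hc))
    · refine div_le_div_of_nonneg_right (le_trans ?_ (hle_tsum j _)) hc.le
      exact mul_le_mul_of_nonneg_left
        (le_add_of_nonneg_left (savings_fst_pos (hf j) _).le) (hw j).le
    · refine tendsto_atTop_atTop_of_monotone (monotone_nat_of_le_succ fun n => ?_) fun B => ?_
      · rw [hist_succ, List.reverse_append, List.reverse_singleton, List.singleton_append]
        exact savings_snd_le_cons _ _
      · obtain ⟨n, hn⟩ := hunb B
        have := le_savings_signedBet hp (hsize (b, k)) s a ω setting hset n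
        rw [hb] at this
        refine ⟨n, hn.le.trans (this.trans_eq ?_)⟩
        simp only [f, j, hb]

theorem exists_forall_frequently_eq (S : Type*) [Fintype S] [Nonempty S] :
    ∃ σ : ℕ → S, ∀ s N, ∃ n ≥ N, σ n = s := by
  let e := Fintype.equivFin S
  refine ⟨fun n => e.symm ⟨n % Fintype.card S, Nat.mod_lt _ Fintype.card_pos⟩, fun s N => ?_⟩
  refine ⟨(e s : ℕ) + N * Fintype.card S, ?_, ?_⟩
  · exact le_add_left (Nat.le_mul_of_pos_right _ Fintype.card_pos)
  · simp [Nat.mod_eq_of_lt (e s).isLt]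

/-- **Conditional-frequency forcing with settings.**
In the game where at each round Skeptic announces bets `{qₙ(·|s)}_{s∈S}` and a
setting `sₙ` (as functions of the past history) and Reality announces `ωₙ`, with
capital `Kₙ = Kₙ₋₁ · qₙ(ωₙ|sₙ)/p(ωₙ|sₙ)`, Skeptic has a strategy choosing every
setting infinitely often such that for each play: either `Kₙ → ∞`, or every
conditional empirical frequency `#{i ≤ n : ωᵢ = a, sᵢ = s}/#{i ≤ n : sᵢ = s}`
converges to `p(a|s)`. -/
theorem conditional_frequency_forcing
    {Ω S : Type*} [Fintype Ω] [Nonempty Ω] [DecidableEq Ω]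
    [Fintype S] [Nonempty S] [DecidableEq S]
    (p : S → Ω → ℝ) (hp : ∀ s a, p s a ∈ Set.Ioo (0 : ℝ) 1)
    (hpsum : ∀ s, ∑ a, p s a = 1) :
    ∃ strat : List Ω → (S → Ω → ℝ) × S,
      (∀ h s, (∀ a, (strat h).1 s a ∈ Set.Ioo (0 : ℝ) 1) ∧ ∑ a, (strat h).1 s a = 1) ∧
      ∀ ω : ℕ → Ω, ∀ setting : ℕ → S,
        (∀ n, 1 ≤ n → setting n = (strat (hist ω (n - 1))).2) →
        ((∀ s : S, ∀ N, ∃ n ≥ N, 1 ≤ n ∧ setting n = s) ∧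
          ∀ K : ℕ → ℝ, K 0 = 1 →
            (∀ n, 1 ≤ n → K n = K (n - 1) *
                (strat (hist ω (n - 1))).1 (setting n) (ω n) / p (setting n) (ω n)) →
            (Tendsto K atTop atTop ∨
              ∀ s a, Tendsto
                (fun n => (((Finset.Icc 1 n).filter fun i => ω i = a ∧ setting i = s).card : ℝ) /
                  (((Finset.Icc 1 n).filter fun i => setting i = s).card : ℝ))
                atTop (nhds (p s a)))) := by
  obtain ⟨σ, hσ⟩ := exists_forall_frequently_eq S
  obtain ⟨C, hC0, hCpos, hCmart, hC⟩ := exists_forcing_martingale hp hpsum σ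
  refine ⟨fun h => (fun s a => if s = σ h.length then p s a * C (h ++ [a]) / C h else p s a,
    σ h.length), ?_, ?_⟩
  · intro h s
    by_cases hs : s = σ h.length
    · subst hs
      have hpos : ∀ a, 0 < p (σ h.length) a * C (h ++ [a]) := fun a =>
        mul_pos (hp _ a).1 (hCpos _)
      refine ⟨fun a => ?_, ?_⟩
      · simp only [if_true]
        refine ⟨div_pos (hpos a) (hCpos h), ?_⟩
        obtain ⟨b, hb⟩ : ∃ b, b ≠ a := by
          by_contra! hall
          have := hpsum (σ h.length)
          rw [Fintype.sum_eq_single a fun b hb => absurd (hall b) hb] at this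
          exact (hp _ a).2.ne this
        rw [div_lt_one (hCpos h), ← hCmart h]
        exact Finset.single_lt_sum hb (Finset.mem_univ a) (Finset.mem_univ b) (hpos b)
          fun i _ _ => (hpos i).le
      · simp only [if_true]
        rw [← Finset.sum_div, hCmart, div_self (hCpos h).ne']
    · simpa [hs] using ⟨fun a => hp s a, hpsum s⟩
  · intro ω setting hsetting
    have hset : ∀ n, setting (n + 1) = σ n := fun n => by
      simp [hsetting (n + 1) (by omega), length_hist]
    have hinf : ∀ s : S, ∀ N, ∃ n ≥ N, 1 ≤ n ∧ setting n = s := by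
      intro s N
      obtain ⟨n, hn, hs⟩ := hσ s N
      exact ⟨n + 1, by omega, by omega, (hset n).trans hs⟩
    refine ⟨hinf, fun K hK0 hK => ?_⟩
    have hKC : K = fun n => C (hist ω n) := by
      funext n
      induction n with
      | zero => simp [hK0, hist, hC0]
      | succ n ih =>
        have h1 := (hp (σ n) (ω (n + 1))).1.ne'
        have h2 := (hCpos (hist ω n)).ne'
        rw [hK (n + 1) (by omega), hset, Nat.add_sub_cancel, ih, hist_succ]
        simp only [length_hist, if_true]
        field_simp
    rw [hKC]
    exact hC ω setting hset hinf
end
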